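/- arXiv:1009.1866 — 2 statements merged into one kernel-verified Lean document; each statement's English description precedes it below -/
import Mathlib

section
/- In any polygonal partition of the unit square for the lower-bound tree T (with weights w(λᵢ) = x_{i-1}²/(4d) where x₀ = 1 and xᵢ = x_{i-1}/(2√d)) in which every region has aspect ratio at most d, the region P(λ_{i}) is a triangle for each 1 ≤ i ≤ d, and P(νᵢ) has i+4 sides, each of length at least xᵢ. -/
open MeasureTheory Real

/-- The Euclidean plane. -/
abbrev Plane := EuclideanSpace ℝ (Fin 2)

/-- The unit square. -/
def unitSquare : Set Plane := {x | x 0 ∈ Set.Icc (0:ℝ) 1 ∧ x 1 ∈ Set.Icc (0:ℝ) 1}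

/-- The segment from `a` to `b` is an edge (side) of `P`: a nondegenerate maximal segment
contained in the frontier of `P`. -/
def IsEdgeOf (P : Set Plane) (a b : Plane) : Prop :=
  a ≠ b ∧ segment ℝ a b ⊆ frontier P ∧
    ∀ c d : Plane, segment ℝ a b ⊆ segment ℝ c d → segment ℝ c d ⊆ frontier P →
      segment ℝ c d = segment ℝ a b

/-- The aspect ratio of a planar convex region: `diam(A)^2 / area(A)`. -/
noncomputable def aspectRatio (A : Set Plane) : ℝ :=
  (Metric.diam A) ^ 2 / (volume A).toReal

/-- Twice the signed area of the triangle `a b c`. -/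
def cross (a b c : Plane) : ℝ :=
  (b 0 - a 0) * (c 1 - a 1) - (b 1 - a 1) * (c 0 - a 0)

/-- `v` lists counterclockwise the vertices of a strictly convex polygon without acute angles,
all of whose sides have length at least `r`. -/
structure IsBluntPolygon {m : ℕ} (v : Fin (m + 1) → Plane) (r : ℝ) : Prop where
  cross_pos : ∀ j l, l ≠ j → l ≠ j + 1 → 0 < cross (v j) (v (j + 1)) (v l)
  inner_nonneg : ∀ j, 0 ≤ inner ℝ (v (j + 1) - v j) (v (j + 1 + 1) - v (j + 1))
  le_dist : ∀ j, r ≤ dist (v j) (v (j + 1))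

lemma cross_lineMap (a b y z : Plane) (t : ℝ) :
    cross a b (AffineMap.lineMap y z t) = (1 - t) * cross a b y + t * cross a b z := by
  simp [cross, AffineMap.lineMap_apply]; ring

lemma cross_lineMap_left (a b z : Plane) (t : ℝ) :
    cross (AffineMap.lineMap a b t) b z = (1 - t) * cross a b z := by
  simp [cross, AffineMap.lineMap_apply]; ring

lemma cross_lineMap_right (a b z : Plane) (t : ℝ) :
    cross a (AffineMap.lineMap b a t) z = (1 - t) * cross a b z := by
  simp [cross, AffineMap.lineMap_apply]; ring

@[simp] lemma cross_self_left (a b : Plane) : cross a b a = 0 := by simp [cross]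

@[simp] lemma cross_self_right (a b : Plane) : cross a b b = 0 := by simp [cross]; ring

lemma cross_rotate (a b c : Plane) : cross b c a = cross a b c := by simp [cross]; ring

lemma cross_combination (a b y z : Plane) {α β : ℝ} (h : α + β = 1) :
    cross a b (α • y + β • z) = α * cross a b y + β * cross a b z := by
  obtain rfl : α = 1 - β := by linarith
  simp [cross]; ring

lemma convex_cross_nonneg (a b : Plane) : Convex ℝ {z | 0 ≤ cross a b z} := by
  intro y hy z hz α β hα hβ h
  simp only [Set.mem_ofPred_eq] at *
  rw [cross_combination a b y z h]; positivity

lemma convex_cross_pos (a b : Plane) : Convex ℝ {z | 0 < cross a b z} := by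
  intro y hy z hz α β hα hβ h
  simp only [Set.mem_ofPred_eq] at *
  rw [cross_combination a b y z h]
  rcases hα.eq_or_lt with rfl | hα
  · obtain rfl : β = 1 := by linarith
    simpa using hz
  · positivity

/-- A set lying to the left of the line `a b` has no interior point on that line. -/
lemma notMem_interior_of_cross_eq_zero {P : Set Plane} {a b z : Plane} (hab : a ≠ b)
    (hP : ∀ y ∈ P, 0 ≤ cross a b y) (hz : cross a b z = 0) : z ∉ interior P := by
  intro hzi
  have hpos : 0 < (b 0 - a 0) ^ 2 + (b 1 - a 1) ^ 2 := by
    by_contra h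
    apply hab
    have h0 : b 0 - a 0 = 0 := by nlinarith [sq_nonneg (b 0 - a 0), sq_nonneg (b 1 - a 1)]
    have h1 : b 1 - a 1 = 0 := by nlinarith [sq_nonneg (b 0 - a 0), sq_nonneg (b 1 - a 1)]
    ext i; fin_cases i
    · simp; linarith
    · simp; linarith
  let y : ℝ → Plane := fun ε => !₂[z 0 + ε * (b 1 - a 1), z 1 - ε * (b 0 - a 0)]
  have hy : Continuous y := by
    refine (PiLp.continuous_toLp 2 _).comp (continuous_pi fun i => ?_)
    fin_cases i
    · simp; fun_prop
    · simp; fun_prop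
  have hy0 : y 0 = z := by ext i; fin_cases i <;> simp [y]
  have hev : ∀ᶠ ε in nhds (0 : ℝ), y ε ∈ interior P :=
    hy.continuousAt.eventually_mem (by rw [hy0]; exact isOpen_interior.mem_nhds hzi)
  obtain ⟨δ, hδ, h⟩ := Metric.eventually_nhds_iff.1 hev
  have h1 := hP _ (interior_subset (h (y := δ / 2) (by
    rw [Real.dist_eq, sub_zero, abs_of_pos (by positivity)]; linarith)))
  simp only [cross, y] at h1 hz
  simp at h1
  nlinarith [mul_pos hδ hpos]

namespace IsBluntPolygon

variable {m : ℕ} {v : Fin (m + 1) → Plane} {r : ℝ}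

lemma rotate (h : IsBluntPolygon v r) (k : Fin (m + 1)) :
    IsBluntPolygon (fun j => v (j + k)) r := by
  have e : ∀ j : Fin (m + 1), j + 1 + k = j + k + 1 := fun j => add_right_comm j 1 k
  refine ⟨fun j l h1 h2 => ?_, fun j => ?_, fun j => ?_⟩
  · simp only [e]
    refine h.cross_pos _ _ (by simpa using h1) ?_
    rw [← e]; simpa using h2
  · simp only [e]; exact h.inner_nonneg _
  · simp only [e]; exact h.le_dist _

lemma cross_nonneg (h : IsBluntPolygon v r) (j l : Fin (m + 1)) :
    0 ≤ cross (v j) (v (j + 1)) (v l) := by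
  by_cases h1 : l = j
  · simp [h1]
  by_cases h2 : l = j + 1
  · simp [h2]
  exact (h.cross_pos j l h1 h2).le

lemma cross_nonneg_of_mem (h : IsBluntPolygon v r) (j : Fin (m + 1)) {z : Plane}
    (hz : z ∈ convexHull ℝ (Set.range v)) : 0 ≤ cross (v j) (v (j + 1)) z :=
  convexHull_min (t := {z | 0 ≤ cross (v j) (v (j + 1)) z})
    (by rintro _ ⟨l, rfl⟩; exact h.cross_nonneg j l) (convex_cross_nonneg _ _) hz

lemma ne_succ (h : IsBluntPolygon v r) (hr : 0 < r) (j : Fin (m + 1)) : v j ≠ v (j + 1) :=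
  dist_pos.1 (hr.trans_le (h.le_dist j))

lemma injective (h : IsBluntPolygon v r) (hr : 0 < r) : Function.Injective v := by
  intro j l hjl
  by_contra hne
  by_cases h2 : l = j + 1
  · exact h.ne_succ hr j (h2 ▸ hjl)
  · have := h.cross_pos j l (Ne.symm hne) h2
    rw [← hjl] at this
    simp at this

lemma mem_segment_of_cross_eq_zero (h : IsBluntPolygon v r) (j : Fin (m + 1)) {z : Plane}
    (hz : z ∈ convexHull ℝ (Set.range v)) (hz0 : cross (v j) (v (j + 1)) z = 0) :
    z ∈ segment ℝ (v j) (v (j + 1)) := by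
  by_cases hs : ∃ l, l ≠ j ∧ l ≠ j + 1
  · have e : Set.range v = {v j, v (j + 1)} ∪ v '' {l | l ≠ j ∧ l ≠ j + 1} := by
      ext y; constructor
      · rintro ⟨l, rfl⟩
        by_cases h1 : l = j
        · left; simp [h1]
        by_cases h2 : l = j + 1
        · left; simp [h2]
        exact Or.inr ⟨l, ⟨h1, h2⟩, rfl⟩
      · rintro ((rfl | rfl) | ⟨l, -, rfl⟩) <;> exact ⟨_, rfl⟩
    rw [e, convexHull_union (by simp) (by simpa [Set.Nonempty] using hs), mem_convexJoin] at hz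
    obtain ⟨a, ha, b, hb, hz⟩ := hz
    rw [convexHull_pair] at ha
    have ha0 : 0 ≤ cross (v j) (v (j + 1)) a :=
      (convex_cross_nonneg (v j) (v (j + 1))).segment_subset (by simp) (by simp) ha
    have hb0 : 0 < cross (v j) (v (j + 1)) b :=
      convexHull_min (t := {z | 0 < cross (v j) (v (j + 1)) z})
        (by rintro _ ⟨l, hl, rfl⟩; exact h.cross_pos j l hl.1 hl.2) (convex_cross_pos _ _) hb
    obtain ⟨α, β, hα, hβ, hαβ, rfl⟩ := hz
    rw [cross_combination _ _ _ _ hαβ] at hz0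
    have : β = 0 := by
      by_contra hβ0
      have := lt_of_le_of_ne hβ (Ne.symm hβ0)
      nlinarith [mul_nonneg hα ha0, mul_pos this hb0]
    subst this
    obtain rfl : α = 1 := by linarith
    simpa using ha
  · push Not at hs
    have e : Set.range v ⊆ {v j, v (j + 1)} := by
      rintro _ ⟨l, rfl⟩
      by_cases h1 : l = j
      · simp [h1]
      · simp [hs l h1]
    have := convexHull_mono (𝕜 := ℝ) e hz
    rwa [convexHull_pair] at this

lemma isEdgeOf (h : IsBluntPolygon v r) (hr : 0 < r) (j : Fin (m + 1)) :
    IsEdgeOf (convexHull ℝ (Set.range v)) (v j) (v (j + 1)) := by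
  have hne := h.ne_succ hr j
  have hcl : IsClosed (convexHull ℝ (Set.range v)) :=
    ((Set.finite_range v).isCompact_convexHull (𝕜 := ℝ)).isClosed
  refine ⟨hne, fun z hz => ?_, fun c e hsub hfr => ?_⟩
  · have hzP : z ∈ convexHull ℝ (Set.range v) :=
      segment_subset_convexHull (Set.mem_range_self j) (Set.mem_range_self (j + 1)) hz
    rw [hcl.frontier_eq]
    refine ⟨hzP, notMem_interior_of_cross_eq_zero hne (fun y hy => h.cross_nonneg_of_mem j hy) ?_⟩
    obtain ⟨α, β, hα, hβ, hαβ, rfl⟩ := hz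
    rw [cross_combination _ _ _ _ hαβ]; simp
  · have hcP := hcl.frontier_subset (hfr (left_mem_segment ℝ c e))
    have heP := hcl.frontier_subset (hfr (right_mem_segment ℝ c e))
    have hc0 := h.cross_nonneg_of_mem j hcP
    have he0 := h.cross_nonneg_of_mem j heP
    have h1 := hsub (left_mem_segment ℝ _ _)
    have h2 := hsub (right_mem_segment ℝ _ _)
    have key : cross (v j) (v (j + 1)) c = 0 ∧ cross (v j) (v (j + 1)) e = 0 := by
      obtain ⟨α, β, hα, hβ, hαβ, h1⟩ := h1
      obtain ⟨γ, δ, hγ, hδ, hγδ, h2⟩ := h2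
      have k1 := cross_combination (v j) (v (j + 1)) c e hαβ
      have k2 := cross_combination (v j) (v (j + 1)) c e hγδ
      rw [h1, cross_self_left] at k1
      rw [h2, cross_self_right] at k2
      have a1 : α * cross (v j) (v (j + 1)) c = 0 := by
        nlinarith [mul_nonneg hα hc0, mul_nonneg hβ he0]
      have a2 : β * cross (v j) (v (j + 1)) e = 0 := by linarith
      have a3 : γ * cross (v j) (v (j + 1)) c = 0 := by
        nlinarith [mul_nonneg hγ hc0, mul_nonneg hδ he0]
      have a4 : δ * cross (v j) (v (j + 1)) e = 0 := by linarith
      constructor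
      · by_contra hcc
        have hα0 : α = 0 := by simpa [hcc] using a1
        have hγ0 : γ = 0 := by simpa [hcc] using a3
        apply hne
        rw [← h1, ← h2, hα0, hγ0, show β = 1 by linarith, show δ = 1 by linarith]
      · by_contra hcc
        have hα0 : β = 0 := by simpa [hcc] using a2
        have hγ0 : δ = 0 := by simpa [hcc] using a4
        apply hne
        rw [← h1, ← h2, hα0, hγ0, show α = 1 by linarith, show γ = 1 by linarith]
    refine Set.Subset.antisymm ((convex_segment _ _).segment_subset ?_ ?_) hsub
    · exact h.mem_segment_of_cross_eq_zero j hcP key.1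
    · exact h.mem_segment_of_cross_eq_zero j heP key.2

end IsBluntPolygon

/-- The vertices of the polygon obtained from `v` by cutting off `v 0` along the segment from `q`,
on the side `v 0, v 1`, to `p`, on the side `v m, v 0`. -/
def cutVertex {m : ℕ} (v : Fin (m + 1) → Plane) (p q : Plane) : Fin (m + 2) → Plane :=
  Fin.snoc (α := fun _ => Plane) (Function.update v 0 q) p

section Cut

variable {m : ℕ} {v : Fin (m + 1) → Plane} {p q : Plane}

@[simp] lemma cutVertex_last : cutVertex v p q (Fin.last (m + 1)) = p := by
  simp [cutVertex]

@[simp] lemma cutVertex_zero : cutVertex v p q 0 = q := by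
  have : (0 : Fin (m + 2)) = Fin.castSucc 0 := rfl
  rw [cutVertex, this, Fin.snoc_castSucc]; simp

lemma cutVertex_castSucc {k : Fin (m + 1)} (hk : k ≠ 0) :
    cutVertex v p q k.castSucc = v k := by
  simp [cutVertex, hk]

lemma cutVertex_cases (l : Fin (m + 2)) :
    l = Fin.last (m + 1) ∨ l = 0 ∨ ∃ k : Fin (m + 1), k ≠ 0 ∧ l = k.castSucc := by
  induction l using Fin.lastCases with
  | last => exact Or.inl rfl
  | cast k =>
    by_cases hk : k = 0
    · subst hk; exact Or.inr (Or.inl rfl)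
    · exact Or.inr (Or.inr ⟨k, hk, rfl⟩)

/-- Every side of the cut polygon other than the new one lies along a side of the old polygon. -/
lemma exists_cutVertex_edge (hm : 1 ≤ m) {s t : ℝ} (hs : s < 1) (ht : t < 1)
    (j : Fin (m + 1)) :
    ∃ c > 0, cutVertex v (AffineMap.lineMap (v 0) (v (Fin.last m)) t)
          (AffineMap.lineMap (v 0) (v 1) s) (j.castSucc + 1) -
        cutVertex v (AffineMap.lineMap (v 0) (v (Fin.last m)) t)
          (AffineMap.lineMap (v 0) (v 1) s) j.castSucc = (c : ℝ) • (v (j + 1) - v j) ∧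
      ∀ z, cross (cutVertex v (AffineMap.lineMap (v 0) (v (Fin.last m)) t)
          (AffineMap.lineMap (v 0) (v 1) s) j.castSucc)
        (cutVertex v (AffineMap.lineMap (v 0) (v (Fin.last m)) t)
          (AffineMap.lineMap (v 0) (v 1) s) (j.castSucc + 1)) z =
        c * cross (v j) (v (j + 1)) z := by
  obtain ⟨m, rfl⟩ : ∃ k, m = k + 1 := ⟨m - 1, by omega⟩
  induction j using Fin.lastCases with
  | last =>
    refine ⟨1 - t, by linarith, ?_⟩
    have e : (Fin.last (m + 1)).castSucc + 1 = Fin.last (m + 1 + 1) := by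
      simp
    rw [e, cutVertex_last, cutVertex_castSucc (by simp [Fin.ext_iff]), Fin.last_add_one]
    refine ⟨?_, fun z => cross_lineMap_right _ _ _ _⟩
    ext i; simp [AffineMap.lineMap_apply]; ring
  | cast k =>
    have e : k.castSucc.castSucc + 1 = k.succ.castSucc := by simp
    have e' : k.castSucc + 1 = k.succ := by simp
    rw [e, cutVertex_castSucc (Fin.succ_ne_zero k), e']
    by_cases hk : k.castSucc = 0
    · refine ⟨1 - s, by linarith, ?_⟩
      have hk1 : k.succ = 1 := by rw [← e', hk, zero_add]
      rw [hk, Fin.castSucc_zero, cutVertex_zero, hk1]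
      refine ⟨?_, fun z => cross_lineMap_left _ _ _ _⟩
      ext i; simp [AffineMap.lineMap_apply]; ring
    · refine ⟨1, one_pos, ?_⟩
      rw [cutVertex_castSucc hk]
      simp

/-- Cutting off a blunt corner leaves a polygon without acute angles. -/
lemma IsBluntPolygon.cut {r r' s t : ℝ} (h : IsBluntPolygon v r) (hm : 2 ≤ m)
    (hs0 : 0 < s) (hs : s < 1) (ht0 : 0 < t) (ht : t < 1)
    (hp : p = AffineMap.lineMap (v 0) (v (Fin.last m)) t)
    (hq : q = AffineMap.lineMap (v 0) (v 1) s)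
    (hpq : ∀ k ≠ 0, 0 < cross p q (v k))
    (hrr : r' ≤ r) (hr1 : r' ≤ dist q (v 1)) (hrm : r' ≤ dist (v (Fin.last m)) p)
    (hrpq : r' ≤ dist p q) : IsBluntPolygon (cutVertex v p q) r' := by
  have hm0 : Fin.last m ≠ 0 := by simp [Fin.ext_iff]; omega
  have h10 : (1 : Fin (m + 1)) ≠ 0 := by
    obtain ⟨m, rfl⟩ : ∃ k, m = k + 1 := ⟨m - 1, by omega⟩
    simp
  have h1v : ((1 : Fin (m + 1)) : ℕ) = 1 := by
    rw [Fin.val_one']; exact Nat.mod_eq_of_lt (by omega)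
  have hedge := exists_cutVertex_edge (v := v) (by omega) hs ht
  rw [← hp, ← hq] at hedge
  have hlast : (Fin.last (m + 1)) + 1 = 0 := Fin.last_add_one _
  have succ_last : (Fin.last m).castSucc + 1 = Fin.last (m + 1) := by simp
  have h01 : (0 : Fin (m + 1 + 1)) = (0 : Fin (m + 1)).castSucc := rfl
  have hin : ∀ k : Fin (m + 1), 0 ≤ inner ℝ (v (k + 1) - v k) (v (k + 1 + 1) - v (k + 1)) :=
    h.inner_nonneg
  have hqp : q - p = s • (v 1 - v 0) + t • (v 0 - v (Fin.last m)) := by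
    rw [hp, hq]; ext i; simp [AffineMap.lineMap_apply]; ring
  have hcorner : 0 ≤ inner ℝ (v 0 - v (Fin.last m)) (v 1 - v 0) := by
    have := hin (Fin.last m)
    rwa [Fin.last_add_one, zero_add] at this
  refine ⟨fun j l hlj hlj1 => ?_, fun j => ?_, fun j => ?_⟩
  · induction j using Fin.lastCases with
    | last =>
      rw [hlast] at hlj1 ⊢
      obtain rfl | rfl | ⟨k, hk, rfl⟩ := cutVertex_cases l
      · exact absurd rfl hlj
      · exact absurd rfl hlj1
      · rw [cutVertex_last, cutVertex_zero, cutVertex_castSucc hk]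
        exact hpq k hk
    | cast j =>
      obtain ⟨c, hc, -, hz⟩ := hedge j
      rw [hz]
      refine mul_pos hc ?_
      have hj1 := Fin.val_add_one j
      have hjl := j.isLt
      obtain rfl | rfl | ⟨k, hk, rfl⟩ := cutVertex_cases l
      · rw [cutVertex_last, hp, cross_lineMap]
        have hjm : j ≠ Fin.last m := fun hh => hlj1 (by rw [hh, succ_last])
        rw [if_neg hjm] at hj1
        have c0 := h.cross_nonneg j 0
        have cm := h.cross_nonneg j (Fin.last m)
        by_cases hj0 : j = 0
        · have : 0 < cross (v j) (v (j + 1)) (v (Fin.last m)) := by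
            refine h.cross_pos _ _ (Ne.symm hjm) fun hh => ?_
            rw [Fin.ext_iff, hj1, hj0] at hh
            simp at hh; omega
          have := mul_pos ht0 this
          nlinarith [mul_nonneg (sub_nonneg.2 ht.le) c0]
        · have : 0 < cross (v j) (v (j + 1)) (v 0) := by
            refine h.cross_pos _ _ (Ne.symm hj0) fun hh => ?_
            rw [Fin.ext_iff, hj1] at hh
            simp at hh
          have := mul_pos (sub_pos.2 ht) this
          nlinarith [mul_nonneg ht0.le cm]
      · rw [cutVertex_zero, hq, cross_lineMap]
        have hj0 : j ≠ 0 := fun hh => hlj (by rw [hh]; rfl)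
        have c0 := h.cross_nonneg j 0
        have c1 := h.cross_nonneg j 1
        by_cases hjm : j = Fin.last m
        · have : 0 < cross (v j) (v (j + 1)) (v 1) := by
            refine h.cross_pos _ _ (fun hh => ?_) fun hh => ?_
            · rw [hjm, Fin.ext_iff, h1v, Fin.val_last] at hh
              omega
            · rw [hjm, Fin.last_add_one] at hh
              exact h10 hh
          have := mul_pos hs0 this
          nlinarith [mul_nonneg (sub_nonneg.2 hs.le) c0]
        · rw [if_neg hjm] at hj1
          have : 0 < cross (v j) (v (j + 1)) (v 0) := by
            refine h.cross_pos _ _ (Ne.symm hj0) fun hh => ?_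
            rw [Fin.ext_iff, hj1] at hh
            simp at hh
          have := mul_pos (sub_pos.2 hs) this
          nlinarith [mul_nonneg hs0.le c1]
      · rw [cutVertex_castSucc hk]
        refine h.cross_pos _ _ (fun hh => hlj (by rw [hh])) fun hh => hlj1 ?_
        by_cases hjm : j = Fin.last m
        · rw [hjm, Fin.last_add_one] at hh
          exact absurd hh hk
        · rw [if_neg hjm] at hj1
          rw [Fin.ext_iff, Fin.val_add_one, if_neg (by simp [Fin.ext_iff]; omega), hh]
          simp [hj1]
  · induction j using Fin.lastCases with
    | last =>
      rw [hlast, cutVertex_last, cutVertex_zero]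
      obtain ⟨c, hc, he, -⟩ := hedge 0
      rw [← h01, cutVertex_zero, zero_add, zero_add] at he
      rw [zero_add, he, hqp, inner_smul_right, inner_add_left, inner_smul_left, inner_smul_left]
      have := real_inner_self_nonneg (x := v 1 - v 0)
      simp only [conj_trivial]
      positivity
    | cast j =>
      obtain ⟨c, hc, he, -⟩ := hedge j
      by_cases hjm : j = Fin.last m
      · rw [he, hjm, succ_last, hlast, cutVertex_last, cutVertex_zero, Fin.last_add_one, hqp,
          inner_smul_left, inner_add_right, inner_smul_right, inner_smul_right]
        have := real_inner_self_nonneg (x := v 0 - v (Fin.last m))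
        simp only [conj_trivial]
        positivity
      · have e : j.castSucc + 1 = (j + 1).castSucc := by
          rw [Fin.ext_iff, Fin.val_add_one, if_neg (by simp [Fin.ext_iff]; omega),
            Fin.val_castSucc, Fin.val_castSucc, Fin.val_add_one, if_neg hjm]
        obtain ⟨c', hc', he', -⟩ := hedge (j + 1)
        rw [he, e, he', inner_smul_left, inner_smul_right]
        have := hin j
        simp only [conj_trivial]
        positivity
  · induction j using Fin.lastCases with
    | last => rwa [hlast, cutVertex_last, cutVertex_zero]
    | cast j =>
      by_cases hjm : j = Fin.last m
      · rw [hjm, succ_last, cutVertex_last, cutVertex_castSucc hm0]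
        exact hrm
      · have e : j.castSucc + 1 = (j + 1).castSucc := by
          rw [Fin.ext_iff, Fin.val_add_one, if_neg (by simp [Fin.ext_iff]; omega),
            Fin.val_castSucc, Fin.val_castSucc, Fin.val_add_one, if_neg hjm]
        have hj1 : j + 1 ≠ 0 := by
          rw [Ne, Fin.ext_iff, Fin.val_add_one, if_neg hjm]; simp
        rw [e, cutVertex_castSucc hj1]
        by_cases hj0 : j = 0
        · rw [hj0, ← h01, cutVertex_zero, zero_add]
          exact hr1
        · rw [cutVertex_castSucc hj0]
          exact hrr.trans (h.le_dist j)

end Cut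

section HalfPlane

variable {g : Plane → ℝ} {A B C : ℝ}

lemma affine_combination (hg : ∀ z, g z = A * z 0 + B * z 1 + C) (y z : Plane) {α β : ℝ}
    (h : α + β = 1) : g (α • y + β • z) = α * g y + β * g z := by
  obtain rfl : α = 1 - β := by linarith
  simp [hg]; ring

lemma affine_lineMap (hg : ∀ z, g z = A * z 0 + B * z 1 + C) (y z : Plane) (t : ℝ) :
    g (AffineMap.lineMap y z t) = (1 - t) * g y + t * g z := by
  simp [hg, AffineMap.lineMap_apply]; ring

lemma convex_affine_nonneg (hg : ∀ z, g z = A * z 0 + B * z 1 + C) : Convex ℝ {z | 0 ≤ g z} := by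
  intro y hy z hz α β hα hβ h
  simp only [Set.mem_ofPred_eq] at *
  rw [affine_combination hg y z h]; positivity

lemma convex_affine_nonpos (hg : ∀ z, g z = A * z 0 + B * z 1 + C) : Convex ℝ {z | g z ≤ 0} := by
  intro y hy z hz α β hα hβ h
  simp only [Set.mem_ofPred_eq] at *
  rw [affine_combination hg y z h]
  nlinarith [mul_nonneg hα (sub_nonneg.2 hy), mul_nonneg hβ (sub_nonneg.2 hz)]

lemma convex_affine_neg (hg : ∀ z, g z = A * z 0 + B * z 1 + C) : Convex ℝ {z | g z < 0} := by
  intro y hy z hz α β hα hβ h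
  simp only [Set.mem_ofPred_eq] at *
  rw [affine_combination hg y z h]
  rcases hα.eq_or_lt with rfl | hα
  · obtain rfl : β = 1 := by linarith
    simpa using hz
  · nlinarith [mul_pos hα (neg_pos.2 hy), mul_nonneg hβ (neg_pos.2 hz).le]

/-- Barycentric coordinates with respect to a triangle, applied to an affine function. -/
lemma cross_mul_affine_sub (hg : ∀ z, g z = A * z 0 + B * z 1 + C) (o a b z : Plane) :
    cross o b a * (g z - g o) =
      cross o b z * (g a - g o) + cross a o z * (g b - g o) := by
  simp only [hg, cross]; ring

lemma cross_lineMap_lineMap (o a b z : Plane) (s t : ℝ) :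
    cross (AffineMap.lineMap o a t) (AffineMap.lineMap o b s) z =
      s * cross o b z + t * cross a o z - t * s * cross o b a := by
  simp [cross, AffineMap.lineMap_apply]; ring

/-- The signed area over the segment where `g` vanishes is proportional to `g`. -/
lemma mul_cross_lineMap_lineMap (hg : ∀ z, g z = A * z 0 + B * z 1 + C) (o a b z : Plane)
    {s t : ℝ} (hs : s * (g o - g b) = g o) (ht : t * (g o - g a) = g o) :
    g o * cross (AffineMap.lineMap o a t) (AffineMap.lineMap o b s) z =
      -(t * s * cross o b a * g z) := by
  rw [cross_lineMap_lineMap]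
  linear_combination (t * s) * cross_mul_affine_sub hg o a b z - s * cross o b z * ht -
    t * cross a o z * hs

/-- A point of the angle `a o b` on the zero line of `g` lies between the points where this line
meets the two rays. -/
lemma mem_segment_of_affine_eq_zero (hg : ∀ z, g z = A * z 0 + B * z 1 + C) {o a b c : Plane}
    {s t : ℝ} (hs : s * (g o - g b) = g o) (ht : t * (g o - g a) = g o)
    (hs0 : 0 < s) (ht0 : 0 < t) (ho : 0 < g o) (hD : 0 < cross o b a)
    (hX : 0 ≤ cross o b c) (hY : 0 ≤ cross a o c) (hc : g c = 0) :
    c ∈ segment ℝ (AffineMap.lineMap o a t) (AffineMap.lineMap o b s) := by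
  have hz := mul_cross_lineMap_lineMap hg o a b c hs ht
  rw [hc, cross_lineMap_lineMap, mul_zero, neg_zero, mul_eq_zero, or_iff_right ho.ne'] at hz
  refine ⟨cross o b c / (t * cross o b a), cross a o c / (s * cross o b a),
    by positivity, by positivity, ?_, ?_⟩
  · field_simp
    linarith
  · have hsum : cross o b c / (t * cross o b a) + cross a o c / (s * cross o b a) = 1 := by
      field_simp
      linarith
    have e : ∀ i, (cross o b a) * (c i - o i) =
        cross o b c * (a i - o i) + cross a o c * (b i - o i) := by
      intro i
      fin_cases i
      · simp [cross]; ring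
      · simp [cross]; ring
    ext i
    have := e i
    simp only [AffineMap.lineMap_apply, PiLp.add_apply, PiLp.smul_apply, smul_eq_mul,
      vsub_eq_sub, vadd_eq_add, PiLp.sub_apply]
    have e2 : cross o b c / (t * cross o b a) * (t * (a i - o i) + o i) +
        cross a o c / (s * cross o b a) * (s * (b i - o i) + o i) =
        (cross o b c * (a i - o i) + cross a o c * (b i - o i)) / cross o b a +
        (cross o b c / (t * cross o b a) + cross a o c / (s * cross o b a)) * o i := by
      field_simp
      ring
    rw [e2, hsum, ← this]
    field_simp
    ring

/-- The two pieces into which a line separating `v 0` from the other vertices cuts a polygon. -/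
lemma IsBluntPolygon.halfPlane_inter {m : ℕ} {v : Fin (m + 1) → Plane} {r : ℝ}
    (h : IsBluntPolygon v r) (hm : 2 ≤ m) (hg : ∀ z, g z = A * z 0 + B * z 1 + C)
    (h0 : 0 < g (v 0)) (hneg : ∀ k ≠ 0, g (v k) < 0) :
    ∃ s t : ℝ, 0 < s ∧ s < 1 ∧ 0 < t ∧ t < 1 ∧ ∃ p q : Plane,
      p = AffineMap.lineMap (v 0) (v (Fin.last m)) t ∧ q = AffineMap.lineMap (v 0) (v 1) s ∧
      (∀ k ≠ 0, 0 < cross p q (v k)) ∧ cross p q (v 0) < 0 ∧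
      convexHull ℝ (Set.range v) ∩ {z | 0 ≤ g z} = convexHull ℝ {v 0, p, q} ∧
      convexHull ℝ (Set.range v) ∩ {z | g z ≤ 0} =
        convexHull ℝ (Set.range (cutVertex v p q)) := by
  have hm0 : Fin.last m ≠ 0 := by simp [Fin.ext_iff]; omega
  have h1v : ((1 : Fin (m + 1)) : ℕ) = 1 := by
    rw [Fin.val_one']; exact Nat.mod_eq_of_lt (by omega)
  have h10 : (1 : Fin (m + 1)) ≠ 0 := by rw [Ne, Fin.ext_iff, h1v]; simp
  have hm1 : Fin.last m ≠ 1 := by rw [Ne, Fin.ext_iff, h1v, Fin.val_last]; omega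
  have ga := hneg _ hm0
  have gb := hneg _ h10
  have hD : 0 < cross (v 0) (v 1) (v (Fin.last m)) := by
    have := h.cross_pos 0 (Fin.last m) hm0 (by rwa [zero_add])
    rwa [zero_add] at this
  set s := g (v 0) / (g (v 0) - g (v 1)) with hs_def
  set t := g (v 0) / (g (v 0) - g (v (Fin.last m))) with ht_def
  have hs : s * (g (v 0) - g (v 1)) = g (v 0) := div_mul_cancel₀ _ (by linarith)
  have ht : t * (g (v 0) - g (v (Fin.last m))) = g (v 0) := div_mul_cancel₀ _ (by linarith)
  have hs0 : 0 < s := div_pos h0 (by linarith)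
  have ht0 : 0 < t := div_pos h0 (by linarith)
  have hs1 : s < 1 := (div_lt_one (by linarith)).2 (by linarith)
  have ht1 : t < 1 := (div_lt_one (by linarith)).2 (by linarith)
  have hcr := fun z => mul_cross_lineMap_lineMap hg (v 0) (v (Fin.last m)) (v 1) z hs ht
  refine ⟨s, t, hs0, hs1, ht0, ht1, _, _, rfl, rfl, fun k hk => ?_, ?_, ?_⟩
  · have hk' := hneg k hk
    refine pos_of_mul_pos_right (a := g (v 0)) ?_ h0.le
    rw [hcr]
    have := mul_pos (mul_pos (mul_pos ht0 hs0) hD) (neg_pos.2 hk')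
    linarith
  · have h2 := hcr (v 0)
    have := mul_pos (mul_pos (mul_pos ht0 hs0) hD) h0
    by_contra hcon
    nlinarith [mul_nonneg h0.le (not_lt.1 hcon)]
  set p : Plane := AffineMap.lineMap (v 0) (v (Fin.last m)) t with hp
  set q : Plane := AffineMap.lineMap (v 0) (v 1) s with hq
  have hgp : g p = 0 := by rw [hp, affine_lineMap hg]; linarith
  have hgq : g q = 0 := by rw [hq, affine_lineMap hg]; linarith
  have hvP : ∀ k, v k ∈ convexHull ℝ (Set.range v) := fun k => subset_convexHull ℝ _ (Set.mem_range_self k)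
  have hPc : Convex ℝ (convexHull ℝ (Set.range v)) := convex_convexHull ℝ _
  have hpP : p ∈ convexHull ℝ (Set.range v) :=
    hPc.lineMap_mem (hvP _) (hvP _) ⟨ht0.le, ht1.le⟩
  have hqP : q ∈ convexHull ℝ (Set.range v) :=
    hPc.lineMap_mem (hvP _) (hvP _) ⟨hs0.le, hs1.le⟩
  have hrange : Set.range v = insert (v 0) (v '' {k | k ≠ 0}) := by
    ext y; constructor
    · rintro ⟨l, rfl⟩
      by_cases hl : l = 0
      · left; rw [hl]
      · exact Or.inr ⟨l, hl, rfl⟩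
    · rintro (rfl | ⟨l, -, rfl⟩) <;> exact ⟨_, rfl⟩
  have hsplit : ∀ z ∈ convexHull ℝ (Set.range v), ∃ y ∈ convexHull ℝ (v '' {k | k ≠ 0}),
      ∃ c ∈ segment ℝ p q, (0 ≤ g z → z ∈ segment ℝ (v 0) c) ∧ (g z ≤ 0 → z ∈ segment ℝ c y) := by
    intro z hz
    have hz' := hz
    rw [hrange, convexHull_insert ((Set.nonempty_of_mem (x := (1 : Fin (m + 1))) h10).image v), mem_convexJoin] at hz
    obtain ⟨o, ho, y, hy, hzs⟩ := hz
    rw [Set.mem_singleton_iff] at ho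
    subst ho
    have hgy : g y < 0 := convexHull_min (t := {z | g z < 0})
      (by rintro _ ⟨l, hl, rfl⟩; exact hneg l hl) (convex_affine_neg hg) hy
    have hyP : y ∈ convexHull ℝ (Set.range v) := convexHull_mono (Set.image_subset_range _ _) hy
    set u := g (v 0) / (g (v 0) - g y) with hu_def
    have hu : u * (g (v 0) - g y) = g (v 0) := div_mul_cancel₀ _ (by linarith)
    have hu0 : 0 < u := div_pos h0 (by linarith)
    have hu1 : u < 1 := (div_lt_one (by linarith)).2 (by linarith)
    have hcP : AffineMap.lineMap (v 0) y u ∈ convexHull ℝ (Set.range v) :=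
      hPc.lineMap_mem (hvP _) hyP ⟨hu0.le, hu1.le⟩
    have hX := h.cross_nonneg_of_mem 0 hcP
    have hY := h.cross_nonneg_of_mem (Fin.last m) hcP
    rw [zero_add] at hX
    rw [Fin.last_add_one] at hY
    refine ⟨y, hy, AffineMap.lineMap (v 0) y u,
      mem_segment_of_affine_eq_zero hg hs ht hs0 ht0 h0 hD hX hY
        (by rw [affine_lineMap hg]; linarith), ?_⟩
    rw [segment_eq_image_lineMap] at hzs
    obtain ⟨w, ⟨hw0, hw1⟩, rfl⟩ := hzs
    rw [affine_lineMap hg]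
    constructor
    · intro hzg
      have hwu : w ≤ u := by
        by_contra hcon
        nlinarith [mul_pos (sub_pos.2 (not_le.1 hcon)) (show 0 < g (v 0) - g y by linarith)]
      rw [segment_eq_image_lineMap]
      refine ⟨w / u, ⟨by positivity, (div_le_one hu0).2 hwu⟩, ?_⟩
      ext i
      simp [AffineMap.lineMap_apply]
      field_simp
    · intro hzg
      have hwu : u ≤ w := by
        by_contra hcon
        nlinarith [mul_pos (sub_pos.2 (not_le.1 hcon)) (show 0 < g (v 0) - g y by linarith)]
      have hu1' : 0 < 1 - u := by linarith
      rw [segment_eq_image_lineMap]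
      refine ⟨(w - u) / (1 - u), ⟨div_nonneg (by linarith) hu1'.le,
        (div_le_one hu1').2 (by linarith)⟩, ?_⟩
      ext i
      simp [AffineMap.lineMap_apply]
      field_simp
      ring
  constructor
  · refine Set.Subset.antisymm ?_ (convexHull_min ?_ (hPc.inter (convex_affine_nonneg hg)))
    · rintro z ⟨hz, hzg⟩
      obtain ⟨y, -, c, hc, h1, -⟩ := hsplit z hz
      refine (convex_convexHull ℝ _).segment_subset (subset_convexHull ℝ _ (by simp)) ?_ (h1 hzg)
      exact segment_subset_convexHull (by simp) (by simp) hc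
    · rintro z (rfl | rfl | rfl)
      · exact ⟨hvP 0, h0.le⟩
      · exact ⟨hpP, hgp.ge⟩
      · exact ⟨hqP, hgq.ge⟩
  · refine Set.Subset.antisymm ?_ (convexHull_min ?_ (hPc.inter (convex_affine_nonpos hg)))
    · rintro z ⟨hz, hzg⟩
      obtain ⟨y, hy, c, hc, -, h1⟩ := hsplit z hz
      refine (convex_convexHull ℝ _).segment_subset ?_ ?_ (h1 hzg)
      · exact segment_subset_convexHull (Set.mem_range.2 ⟨Fin.last _, cutVertex_last⟩)
          (Set.mem_range.2 ⟨0, cutVertex_zero⟩) hc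
      · refine convexHull_mono ?_ hy
        rintro _ ⟨k, hk, rfl⟩
        exact ⟨k.castSucc, cutVertex_castSucc hk⟩
    · rintro _ ⟨l, rfl⟩
      obtain rfl | rfl | ⟨k, hk, rfl⟩ := cutVertex_cases l
      · rw [cutVertex_last]; exact ⟨hpP, hgp.le⟩
      · rw [cutVertex_zero]; exact ⟨hqP, hgq.le⟩
      · rw [cutVertex_castSucc hk]; exact ⟨hvP k, (hneg k hk).le⟩

end HalfPlane

/-- Two closed convex sets with disjoint interiors covering a convex planar set are cut out of it
by a line. -/
lemma exists_affine_separating {P L Q : Set Plane} (hP : Convex ℝ P) (hL : Convex ℝ L)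
    (hQ : Convex ℝ Q) (hLc : IsClosed L) (hQc : IsClosed Q) (hLQ : L ∪ Q = P)
    (hd : Disjoint (interior L) (interior Q)) (hLi : (interior L).Nonempty) (hPL : ¬ P ⊆ L) :
    ∃ (g : Plane → ℝ) (A B C : ℝ), (∀ z, g z = A * z 0 + B * z 1 + C) ∧
      (∃ z ∈ P, 0 < g z) ∧ L = P ∩ {z | 0 ≤ g z} ∧ Q = P ∩ {z | g z ≤ 0} := by
  have hQi : (interior Q).Nonempty := by
    by_contra hQi
    rw [Set.not_nonempty_iff_eq_empty] at hQi
    apply hPL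
    have hi : interior P = interior L := by
      rw [← hLQ]; exact interior_union_isClosed_of_interior_empty hLc hQi
    calc P ⊆ closure P := subset_closure
      _ = closure (interior P) :=
        (hP.closure_interior_eq_closure_of_nonempty_interior (hi ▸ hLi)).symm
      _ = closure (interior L) := by rw [hi]
      _ ⊆ L := closure_minimal interior_subset hLc
  obtain ⟨f, u, hfL, hfQ⟩ := geometric_hahn_banach_open_open hL.interior isOpen_interior
    hQ.interior isOpen_interior hd
  have hLsub : ∀ z ∈ L, f z ≤ u := fun z hz => by
    have : z ∈ closure (interior L) := by
      rw [hL.closure_interior_eq_closure_of_nonempty_interior hLi]; exact subset_closure hz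
    exact closure_minimal (t := {z | f z ≤ u}) (fun y hy => (hfL y hy).le)
      (isClosed_le f.continuous continuous_const) this
  have hQsub : ∀ z ∈ Q, u ≤ f z := fun z hz => by
    have : z ∈ closure (interior Q) := by
      rw [hQ.closure_interior_eq_closure_of_nonempty_interior hQi]; exact subset_closure hz
    exact closure_minimal (t := {z | u ≤ f z}) (fun y hy => (hfQ y hy).le)
      (isClosed_le continuous_const f.continuous) this
  obtain ⟨a, ha⟩ := hLi
  obtain ⟨b, hb⟩ := hQi
  have haP : a ∈ P := hLQ ▸ Or.inl (interior_subset ha)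
  have hbP : b ∈ P := hLQ ▸ Or.inr (interior_subset hb)
  refine ⟨fun z => u - f z, -f (EuclideanSpace.single 0 1), -f (EuclideanSpace.single 1 1), u,
    fun z => ?_, ⟨a, haP, sub_pos.2 (hfL a ha)⟩, ?_, ?_⟩
  · have : z = z 0 • EuclideanSpace.single 0 (1 : ℝ) + z 1 • EuclideanSpace.single 1 (1 : ℝ) := by
      ext i; fin_cases i <;> simp
    have hf : f z = z 0 * f (EuclideanSpace.single 0 1) + z 1 * f (EuclideanSpace.single 1 1) := by
      conv_lhs => rw [this]
      simp
    simp only [hf]; ring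
  · refine Set.Subset.antisymm
      (fun z hz => ⟨hLQ ▸ Or.inl hz, sub_nonneg.2 (hLsub z hz)⟩) ?_
    rintro z ⟨hz, hzg⟩
    have hzu : f z ≤ u := sub_nonneg.1 hzg
    have hsub : openSegment ℝ z a ⊆ L := by
      intro y hy
      have hyP : y ∈ P := hP.openSegment_subset hz haP hy
      rw [← hLQ] at hyP
      refine hyP.resolve_right fun hyQ => ?_
      obtain ⟨α, β, hα, hβ, hαβ, rfl⟩ := hy
      have h1 := hQsub _ hyQ
      have h2 := hfL a ha
      obtain rfl : α = 1 - β := by linarith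
      simp only [map_add, map_smul, smul_eq_mul] at h1
      nlinarith [mul_pos hβ (sub_pos.2 h2), mul_nonneg hα.le (sub_nonneg.2 hzu)]
    have : z ∈ closure (openSegment ℝ z a) := by
      rw [closure_openSegment]; exact left_mem_segment ℝ z a
    exact closure_minimal hsub hLc this
  · refine Set.Subset.antisymm
      (fun z hz => ⟨hLQ ▸ Or.inr hz, sub_nonpos.2 (hQsub z hz)⟩) ?_
    rintro z ⟨hz, hzg⟩
    have hzu : u ≤ f z := sub_nonpos.1 hzg
    have hsub : openSegment ℝ z b ⊆ Q := by
      intro y hy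
      have hyP : y ∈ P := hP.openSegment_subset hz hbP hy
      rw [← hLQ] at hyP
      refine hyP.resolve_left fun hyL => ?_
      obtain ⟨α, β, hα, hβ, hαβ, rfl⟩ := hy
      have h1 := hLsub _ hyL
      have h2 := hfQ b hb
      obtain rfl : α = 1 - β := by linarith
      simp only [map_add, map_smul, smul_eq_mul] at h1
      nlinarith [mul_pos hβ (sub_pos.2 h2), mul_nonneg hα.le (sub_nonneg.2 hzu)]
    have : z ∈ closure (openSegment ℝ z b) := by
      rw [closure_openSegment]; exact left_mem_segment ℝ z b
    exact closure_minimal hsub hQc this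

/-- A half-plane containing two vertices of a polygon contains two adjacent ones. -/
lemma IsBluntPolygon.exists_adjacent_nonneg {m : ℕ} {v : Fin (m + 1) → Plane} {r : ℝ}
    (h : IsBluntPolygon v r) {g : Plane → ℝ} {A B C : ℝ}
    (hg : ∀ z, g z = A * z 0 + B * z 1 + C) {j k : Fin (m + 1)} (hjk : j ≠ k)
    (hj : 0 ≤ g (v j)) (hk : 0 ≤ g (v k)) :
    ∃ l, 0 ≤ g (v l) ∧ 0 ≤ g (v (l + 1)) := by
  by_contra! hcon
  have key : ∀ j k : Fin (m + 1), j ≠ k → 0 ≤ g (v j) → 0 ≤ g (v k) → g (v k) < g (v j) := by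
    intro j k hjk hj hk
    have hb := hcon j hj
    have hpred : j - 1 + 1 = j := sub_add_cancel j 1
    have ha : g (v (j - 1)) < 0 := by
      by_contra hcc
      have := hcon _ (not_lt.1 hcc)
      rw [hpred] at this
      linarith
    have hX : 0 < cross (v j) (v (j + 1)) (v k) :=
      h.cross_pos _ _ hjk.symm (by rintro rfl; linarith)
    have hY := h.cross_nonneg (j - 1) k
    rw [hpred] at hY
    have hD := h.cross_nonneg j (j - 1)
    have hid := cross_mul_affine_sub hg (v j) (v (j - 1)) (v (j + 1)) (v k)
    by_contra hcc
    have hcc := not_lt.1 hcc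
    nlinarith [mul_nonneg hD (sub_nonneg.2 hcc),
      mul_pos hX (show 0 < g (v j) - g (v (j - 1)) by linarith),
      mul_nonneg hY (show 0 ≤ g (v j) - g (v (j + 1)) by linarith)]
  exact lt_asymm (key j k hjk hj hk) (key k j hjk.symm hk hj)

/-- The area of a blunt triangle is at most the square of its longest side. -/
lemma volume_triangle_le {o p q : Plane} (h : inner ℝ (p - o) (q - o) ≤ 0) :
    (volume (convexHull ℝ {o, p, q})).toReal ≤ dist p q ^ 2 := by
  set c : Plane := midpoint ℝ p q
  have hsub : convexHull ℝ {o, p, q} ⊆ Metric.closedBall c (dist p q / 2) := by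
    refine convexHull_min ?_ (convex_closedBall _ _)
    rintro z (rfl | rfl | rfl)
    · have e1 : z - c = (1 / 2 : ℝ) • ((z - p) + (z - q)) := by
        simp only [c, midpoint_eq_smul_add, invOf_eq_inv]
        module
      have e2 : dist p q = ‖(z - p) - (z - q)‖ := by
        rw [dist_comm, dist_eq_norm]; congr 1; abel
      rw [Metric.mem_closedBall, dist_eq_norm, e1, norm_smul, e2]
      have h' : inner ℝ (z - p) (z - q) ≤ 0 := by
        rwa [← neg_sub p z, ← neg_sub q z, inner_neg_neg]
      have : ‖(z - p) + (z - q)‖ ≤ ‖(z - p) - (z - q)‖ := by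
        rw [← sq_le_sq₀ (norm_nonneg _) (norm_nonneg _), norm_add_sq_real,
          norm_sub_sq_real (z - p)]
        linarith
      rw [Real.norm_of_nonneg (by norm_num)]
      linarith
    · rw [Metric.mem_closedBall, dist_left_midpoint]; norm_num; linarith
    · rw [Metric.mem_closedBall, dist_right_midpoint]; norm_num; linarith
  have hvol : volume (Metric.closedBall c (dist p q / 2)) ≠ ⊤ :=
    Metric.isBounded_closedBall.measure_lt_top.ne
  refine (ENNReal.toReal_mono hvol (measure_mono hsub)).trans ?_
  rw [EuclideanSpace.volume_closedBall_fin_two, ENNReal.toReal_mul, ENNReal.toReal_pow,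
    ENNReal.toReal_ofReal (by positivity), ENNReal.toReal_ofReal Real.pi_pos.le]
  nlinarith [Real.pi_le_four, sq_nonneg (dist p q)]

lemma affineIndependent_of_cross_ne_zero {a b c : Plane} (h : cross a b c ≠ 0) :
    AffineIndependent ℝ ![a, b, c] := by
  rw [affineIndependent_iff_of_fintype]
  intro w hw h0
  rw [Finset.weightedVSub_eq_linear_combination _ hw] at h0
  have e0 := congrArg (fun z : Plane => z 0) h0
  have e1 := congrArg (fun z : Plane => z 1) h0
  simp [Fin.sum_univ_three] at e0 e1 hw
  have hw0 : w 0 = -w 1 - w 2 := by linarith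
  rw [hw0] at e0 e1
  have h1 : w 1 * cross a b c = 0 := by
    simp only [cross]; linear_combination (c 1 - a 1) * e0 - (c 0 - a 0) * e1
  have h2 : w 2 * cross a b c = 0 := by
    simp only [cross]; linear_combination (b 0 - a 0) * e1 - (b 1 - a 1) * e0
  have h1 : w 1 = 0 := by simpa [h] using h1
  have h2 : w 2 = 0 := by simpa [h] using h2
  intro i
  fin_cases i
  · simp [hw0, h1, h2]
  · exact h1
  · exact h2

lemma Convex.nonempty_interior_of_volume_pos {L : Set Plane} (hL : Convex ℝ L)
    (h : 0 < (volume L).toReal) : (interior L).Nonempty := by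
  by_contra hcon
  rw [Set.not_nonempty_iff_eq_empty] at hcon
  have hsub : L ⊆ frontier L := by
    rw [frontier, hcon, Set.sdiff_empty]; exact subset_closure
  have : volume L = 0 := measure_mono_null hsub (hL.addHaar_frontier volume)
  simp [this] at h

/-- The conclusion of `IsBluntPolygon.split` when the separating line cuts off the corner `v 0`. -/
lemma IsBluntPolygon.split_zero {m : ℕ} {v : Fin (m + 1) → Plane} {r r' : ℝ}
    (h : IsBluntPolygon v r) (hm : 2 ≤ m) (hr0 : 0 ≤ r') (hr' : r' ≤ r / 2)
    {L Q : Set Plane} {g : Plane → ℝ} {A B C : ℝ} (hg : ∀ z, g z = A * z 0 + B * z 1 + C)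
    (h0 : 0 < g (v 0)) (hneg : ∀ k ≠ 0, g (v k) < 0)
    (hL : L = convexHull ℝ (Set.range v) ∩ {z | 0 ≤ g z})
    (hQ : Q = convexHull ℝ (Set.range v) ∩ {z | g z ≤ 0})
    (hdist : ∀ y ∈ L, ∀ z ∈ L, dist y z ≤ r / 2) (hr'vol : r' ^ 2 ≤ (volume L).toReal) :
    (∃ a b c, AffineIndependent ℝ ![a, b, c] ∧ L = convexHull ℝ {a, b, c}) ∧
      ∃ w : Fin (m + 2) → Plane, IsBluntPolygon w r' ∧ Q = convexHull ℝ (Set.range w) := by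
  obtain ⟨s, t, hs0, hs, ht0, ht, p, q, hp, hq, hpos, hneg0, hLe, hQe⟩ :=
    h.halfPlane_inter hm hg h0 hneg
  rw [← hL] at hLe
  rw [← hQ] at hQe
  have hoL : v 0 ∈ L := hLe ▸ subset_convexHull ℝ _ (by simp)
  have hpL : p ∈ L := hLe ▸ subset_convexHull ℝ _ (by simp)
  have hqL : q ∈ L := hLe ▸ subset_convexHull ℝ _ (by simp)
  refine ⟨⟨v 0, p, q, affineIndependent_of_cross_ne_zero ?_, hLe⟩, cutVertex v p q, ?_, hQe⟩
  · rw [← cross_rotate]; exact hneg0.ne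
  have hin : inner ℝ (p - v 0) (q - v 0) ≤ 0 := by
    have h1 := h.inner_nonneg (Fin.last m)
    rw [Fin.last_add_one, zero_add] at h1
    have hp' : p - v 0 = (-t) • (v 0 - v (Fin.last m)) := by
      rw [hp]; ext i; simp [AffineMap.lineMap_apply]; ring
    have hq' : q - v 0 = s • (v 1 - v 0) := by
      rw [hq]; ext i; simp [AffineMap.lineMap_apply]
    rw [hp', hq', inner_smul_left, inner_smul_right, conj_trivial]
    nlinarith [mul_nonneg ht0.le (mul_nonneg hs0.le h1)]
  refine h.cut hm hs0 hs ht0 ht hp hq hpos ?_ ?_ ?_ ?_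
  · linarith [h.le_dist 0, hdist _ hoL _ hpL, dist_nonneg (x := v 0) (y := p)]
  · have h1 := h.le_dist 0
    rw [zero_add] at h1
    linarith [dist_triangle (v 0) q (v 1), hdist _ hoL _ hqL]
  · have h1 := h.le_dist (Fin.last m)
    rw [Fin.last_add_one] at h1
    linarith [dist_triangle (v (Fin.last m)) p (v 0), hdist _ hpL _ hoL]
  · refine (sq_le_sq₀ hr0 dist_nonneg).1 ?_
    rw [hLe] at hr'vol
    exact hr'vol.trans (volume_triangle_le hin)

/-- Splitting off a convex piece of small diameter from a polygon without acute angles removes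
exactly one corner. -/
lemma IsBluntPolygon.split {m : ℕ} {v : Fin (m + 1) → Plane} {r r' : ℝ}
    (h : IsBluntPolygon v r) (hm : 2 ≤ m) (hr : 0 < r) (hr0 : 0 ≤ r') (hr' : r' ≤ r / 2)
    {L Q : Set Plane} (hL : Convex ℝ L) (hQ : Convex ℝ Q) (hLc : IsCompact L) (hQc : IsClosed Q)
    (hLQ : L ∪ Q = convexHull ℝ (Set.range v)) (hd : Disjoint (interior L) (interior Q))
    (hvol : 0 < (volume L).toReal) (hdiam : Metric.diam L ≤ r / 2)
    (hr'vol : r' ^ 2 ≤ (volume L).toReal) :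
    (∃ a b c, AffineIndependent ℝ ![a, b, c] ∧ L = convexHull ℝ {a, b, c}) ∧
      ∃ w : Fin (m + 2) → Plane, IsBluntPolygon w r' ∧ Q = convexHull ℝ (Set.range w) := by
  have hdist : ∀ {y z}, y ∈ L → z ∈ L → dist y z ≤ r / 2 := fun hy hz =>
    (Metric.dist_le_diam_of_mem hLc.isBounded hy hz).trans hdiam
  have hno : ∀ l, ¬ (v l ∈ L ∧ v (l + 1) ∈ L) := fun l hl => by
    have := hdist hl.1 hl.2
    have := h.le_dist l
    linarith
  have hvP : ∀ k, v k ∈ convexHull ℝ (Set.range v) :=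
    fun k => subset_convexHull ℝ _ (Set.mem_range_self k)
  obtain ⟨g, A, B, C, hg, ⟨z, hzP, hz⟩, hLg, hQg⟩ :=
    exists_affine_separating (convex_convexHull ℝ _) hL hQ hLc.isClosed hQc hLQ hd
      (hL.nonempty_interior_of_volume_pos hvol) fun hsub => hno 0 ⟨hsub (hvP _), hsub (hvP _)⟩
  obtain ⟨j, hj⟩ : ∃ j, 0 < g (v j) := by
    by_contra! hcon
    have : g z ≤ 0 := convexHull_min (t := {z | g z ≤ 0})
      (by rintro _ ⟨k, rfl⟩; exact hcon k) (convex_affine_nonpos hg) hzP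
    linarith
  have hothers : ∀ k, k ≠ j → g (v k) < 0 := by
    intro k hk
    by_contra hcon
    obtain ⟨l, h1, h2⟩ := h.exists_adjacent_nonneg hg hk (not_lt.1 hcon) hj.le
    exact hno l ⟨hLg ▸ ⟨hvP _, h1⟩, hLg ▸ ⟨hvP _, h2⟩⟩
  have hrange : Set.range (fun k => v (k + j)) = Set.range v :=
    (Equiv.addRight j).surjective.range_comp v
  have hrot := h.rotate j
  rw [← hrange] at hLg hQg
  refine (h.rotate j).split_zero hm hr0 hr' hg (by simpa using hj)
    (fun k hk => hothers _ (by simpa using hk)) hLg hQg (fun y hy z hz => hdist hy hz) hr'vol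

/-- The vertices of the unit square. -/
def squareVertex : Fin 4 → Plane := ![!₂[0, 0], !₂[1, 0], !₂[1, 1], !₂[0, 1]]

lemma isBluntPolygon_squareVertex : IsBluntPolygon squareVertex 1 := by
  refine ⟨fun j l h1 h2 => ?_, fun j => ?_, fun j => ?_⟩
  · fin_cases j <;> fin_cases l <;> simp_all [squareVertex, cross]
  · fin_cases j <;> simp [squareVertex, PiLp.inner_apply, Fin.sum_univ_two]
  · fin_cases j <;> simp [squareVertex, EuclideanSpace.dist_eq, Fin.sum_univ_two]

lemma unitSquare_eq_convexHull : unitSquare = convexHull ℝ (Set.range squareVertex) := by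
  have hv : ∀ k, squareVertex k ∈ convexHull ℝ (Set.range squareVertex) :=
    fun k => subset_convexHull ℝ _ (Set.mem_range_self k)
  have hc : Convex ℝ (convexHull ℝ (Set.range squareVertex)) := convex_convexHull ℝ _
  refine Set.Subset.antisymm ?_ (convexHull_min ?_ ?_)
  · rintro z ⟨h0, h1⟩
    have ha := hc.lineMap_mem (hv 0) (hv 1) h0
    have hb := hc.lineMap_mem (hv 3) (hv 2) h0
    convert hc.lineMap_mem ha hb h1 using 1
    ext i
    fin_cases i <;> simp [squareVertex, AffineMap.lineMap_apply]
  · rintro _ ⟨k, rfl⟩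
    fin_cases k <;> simp [squareVertex, unitSquare]
  · rintro y ⟨⟨a1, a2⟩, a3, a4⟩ z ⟨⟨b1, b2⟩, b3, b4⟩ α β hα hβ hαβ
    simp only [unitSquare, Set.mem_ofPred_eq, Set.mem_Icc, PiLp.add_apply, PiLp.smul_apply,
      smul_eq_mul]
    refine ⟨⟨by positivity, ?_⟩, by positivity, ?_⟩
    · nlinarith [mul_le_mul_of_nonneg_left a2 hα, mul_le_mul_of_nonneg_left b2 hβ]
    · nlinarith [mul_le_mul_of_nonneg_left a4 hα, mul_le_mul_of_nonneg_left b4 hβ]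

/-- Lower-bound construction: `T` has path nodes `ν₀, …, ν_d` and leaves `λ₁, …, λ_d`,
where `λ_{i+1}` and `ν_{i+1}` are the children of `ν_i`; set `x₀ = 1`,
`x_{i+1} = x_i/(2√d)` and `w(λ_{i+1}) = x_i²/(4d)`. In any polygonal partition for `T`
in which every region has aspect ratio at most `d`, each `P(λ_{i+1})` is a triangle, and
`P(ν_i)` has `i+4` sides, each of length at least `x_i`. -/
theorem stmt14 (d : ℕ) (hd : 1 ≤ d)
    (x : ℕ → ℝ) (hx0 : x 0 = 1)
    (hxs : ∀ i : ℕ, x (i + 1) = x i / (2 * Real.sqrt d))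
    (Pν : Fin (d + 1) → Set Plane) (PL : Fin d → Set Plane)
    (hν0 : Pν 0 = unitSquare)
    (hconvν : ∀ i, Convex ℝ (Pν i)) (hconvL : ∀ i, Convex ℝ (PL i))
    (hpolyν : ∀ i, ∃ F : Finset Plane, Pν i = convexHull ℝ (F : Set Plane))
    (hpolyL : ∀ i, ∃ F : Finset Plane, PL i = convexHull ℝ (F : Set Plane))
    (hpart : ∀ i : Fin d, PL i ∪ Pν i.succ = Pν i.castSucc)
    (hdisj : ∀ i : Fin d, Disjoint (interior (PL i)) (interior (Pν i.succ)))
    (harea : ∀ i : Fin d, (volume (PL i)).toReal = (x (i : ℕ)) ^ 2 / (4 * d))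
    (haspν : ∀ i, aspectRatio (Pν i) ≤ d) (haspL : ∀ i, aspectRatio (PL i) ≤ d) :
    (∀ i : Fin d, ∃ a b c : Plane,
      AffineIndependent ℝ ![a, b, c] ∧ PL i = convexHull ℝ {a, b, c}) ∧
    (∀ i : Fin (d + 1), ∃ v : Fin ((i : ℕ) + 4) → Plane,
      Function.Injective v ∧
      Pν i = convexHull ℝ (Set.range v) ∧
      ∀ j : Fin ((i : ℕ) + 4),
        IsEdgeOf (Pν i) (v j) (v (j + 1)) ∧ x (i : ℕ) ≤ dist (v j) (v (j + 1))) := by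
  have hd0 : (0 : ℝ) < d := by exact_mod_cast hd
  have hd1 : (1 : ℝ) ≤ d := by exact_mod_cast hd
  have hsq : 0 < √(d : ℝ) := Real.sqrt_pos.2 hd0
  have hxpos : ∀ i, 0 < x i := by
    intro i
    induction i with
    | zero => rw [hx0]; exact one_pos
    | succ i ih => rw [hxs]; positivity
  have hclosed : ∀ P : Set Plane, (∃ F : Finset Plane, P = convexHull ℝ (F : Set Plane)) →
      IsCompact P := by
    rintro _ ⟨F, rfl⟩
    exact F.finite_toSet.isCompact_convexHull (𝕜 := ℝ)
  have step : ∀ (i : Fin d) (v : Fin ((i : ℕ) + 4) → Plane), IsBluntPolygon v (x i) →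
      Pν i.castSucc = convexHull ℝ (Set.range v) →
      (∃ a b c, AffineIndependent ℝ ![a, b, c] ∧ PL i = convexHull ℝ {a, b, c}) ∧
        ∃ w : Fin ((i : ℕ) + 1 + 4) → Plane, IsBluntPolygon w (x (i + 1)) ∧
          Pν i.succ = convexHull ℝ (Set.range w) := by
    intro i v hv hP
    have hx := hxpos i
    have hvol : 0 < (volume (PL i)).toReal := by rw [harea]; positivity
    refine hv.split (m := i + 3) (by omega) hx (hxpos _).le ?_ (hconvL i) (hconvν _)
      (hclosed _ (hpolyL i)) (hclosed _ (hpolyν _)).isClosed ((hpart i).trans hP) (hdisj i)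
      hvol ?_ ?_
    · rw [hxs]
      have : 1 ≤ √(d : ℝ) := Real.one_le_sqrt.2 hd1
      gcongr
      linarith
    · have h1 := haspL i
      rw [aspectRatio, div_le_iff₀ hvol, harea] at h1
      refine (sq_le_sq₀ Metric.diam_nonneg (by positivity)).1 (h1.trans_eq ?_)
      field_simp
      norm_num
    · rw [hxs, harea, div_pow, mul_pow, Real.sq_sqrt hd0.le]
      norm_num
  have main : ∀ (n : ℕ) (hn : n < d + 1), ∃ v : Fin (n + 4) → Plane,
      IsBluntPolygon v (x n) ∧ Pν ⟨n, hn⟩ = convexHull ℝ (Set.range v) := by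
    intro n
    induction n with
    | zero =>
      intro _
      exact ⟨squareVertex, hx0 ▸ isBluntPolygon_squareVertex,
        hν0.trans unitSquare_eq_convexHull⟩
    | succ n ih =>
      intro hn
      obtain ⟨v, hv, hP⟩ := ih (by omega)
      exact (step ⟨n, by omega⟩ v hv hP).2
  refine ⟨fun i => ?_, fun i => ?_⟩
  · obtain ⟨v, hv, hP⟩ := main i (by omega)
    exact (step i v hv hP).1
  · obtain ⟨v, hv, hP⟩ := main i i.isLt
    refine ⟨v, hv.injective (hxpos i), hP, fun j => ⟨?_, hv.le_dist j⟩⟩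
    rw [show Pν i = convexHull ℝ (Set.range v) from hP]
    exact hv.isEdgeOf (hxpos i) j
end

section
/- For any d ≥ 1, there is a properly weighted tree T of depth d such that any polygonal partition for T contains a region of aspect ratio Ω(d); concretely, some region has aspect ratio at least (d+4)/(2π). -/
open MeasureTheory Real

/-- A rooted tree on a finite vertex type, given by its parent function. -/
structure FRTree (V : Type) [Fintype V] [DecidableEq V] where
  root : V
  parent : V → V
  root_fixed : parent root = root
  reaches : ∀ v : V, ∃ k : ℕ, parent^[k] v = root

variable {V : Type} [Fintype V] [DecidableEq V]

/-- The depth of a node. -/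
noncomputable def frNodeDepth (T : FRTree V) (v : V) : ℕ := Nat.find (T.reaches v)

/-- The depth of the tree. -/
noncomputable def frDepth (T : FRTree V) : ℕ := Finset.univ.sup (frNodeDepth T)

/-- The children of a node. -/
def frChildren (T : FRTree V) (v : V) : Finset V :=
  Finset.univ.filter fun u => T.parent u = v ∧ u ≠ v

/-- The linear form on the plane whose gradient is the unit vector at angle `θ`. -/
noncomputable def dirForm (θ : ℝ) (x : Plane) : ℝ := cos θ * x 0 + sin θ * x 1

/-- The point whose coordinates in the orthonormal frame at angle `θ` are `a` and `b`. -/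
noncomputable def framePoint (θ a b : ℝ) : Plane :=
  !₂[a * cos θ - b * sin θ, a * sin θ + b * cos θ]

lemma dirForm_framePoint (φ θ a b : ℝ) :
    dirForm φ (framePoint θ a b) = a * cos (φ - θ) + b * sin (φ - θ) := by
  simp only [dirForm, framePoint, cos_sub, sin_sub]
  simp
  ring

lemma framePoint_dirForm (θ : ℝ) (x : Plane) :
    framePoint θ (dirForm θ x) (dirForm (θ + π / 2) x) = x := by
  have h := sin_sq_add_cos_sq θ
  ext i
  fin_cases i <;> simp [dirForm, framePoint, cos_add_pi_div_two, sin_add_pi_div_two]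
  · linear_combination x 0 * h
  · linear_combination x 1 * h

lemma dirForm_add (θ : ℝ) (x y : Plane) : dirForm θ (x + y) = dirForm θ x + dirForm θ y := by
  simp [dirForm]; ring

lemma dirForm_sub (θ : ℝ) (x y : Plane) : dirForm θ (x - y) = dirForm θ x - dirForm θ y := by
  simp [dirForm]; ring

lemma dirForm_smul (θ c : ℝ) (x : Plane) : dirForm θ (c • x) = c * dirForm θ x := by
  simp [dirForm]; ring

lemma continuous_dirForm (θ : ℝ) : Continuous (dirForm θ) := by
  unfold dirForm; fun_prop

lemma dirForm_eq (θ φ : ℝ) (x : Plane) :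
    dirForm φ x = cos (φ - θ) * dirForm θ x + sin (φ - θ) * dirForm (θ + π / 2) x := by
  conv_lhs => rw [← framePoint_dirForm θ x, dirForm_framePoint]
  ring

lemma dirForm_sq_add_sq (θ : ℝ) (x y : Plane) :
    (dirForm θ x - dirForm θ y) ^ 2 + (dirForm (θ + π / 2) x - dirForm (θ + π / 2) y) ^ 2
      = dist x y ^ 2 := by
  have h := sin_sq_add_cos_sq θ
  rw [EuclideanSpace.dist_eq, Real.sq_sqrt (by positivity)]
  simp only [dirForm, cos_add_pi_div_two, sin_add_pi_div_two, Fin.sum_univ_two, Real.dist_eq, sq_abs]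
  linear_combination ((x 0 - y 0) ^ 2 + (x 1 - y 1) ^ 2) * h

lemma abs_dirForm_sub_le (θ : ℝ) (x y : Plane) : |dirForm θ x - dirForm θ y| ≤ dist x y := by
  apply abs_le_of_sq_le_sq _ dist_nonneg
  nlinarith [dirForm_sq_add_sq θ x y, sq_nonneg (dirForm (θ + π / 2) x - dirForm (θ + π / 2) y)]

lemma volume_le_of_dirForm_mem_Icc {S : Set Plane} {θ a b h w : ℝ}
    (hS : ∀ x ∈ S, dirForm θ x ∈ Set.Icc a (a + h) ∧ dirForm (θ + π / 2) x ∈ Set.Icc b (b + w))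
    (hh : 0 ≤ h) : volume S ≤ ENNReal.ofReal (h * w) := by
  let M : Matrix (Fin 2) (Fin 2) ℝ := !![cos θ, sin θ; -sin θ, cos θ]
  have hM : M.det = 1 := by
    simp only [M, Matrix.det_fin_two_of]; linear_combination sin_sq_add_cos_sq θ
  have h1 := Real.map_matrix_volume_pi_eq_smul_volume_pi (M := M) (by rw [hM]; norm_num)
  rw [hM] at h1
  simp only [inv_one, abs_one, ENNReal.ofReal_one, one_smul] at h1
  have hc : Measurable (Matrix.toLin' M) :=
    (LinearMap.continuous_of_finiteDimensional (Matrix.toLin' M)).measurable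
  have hmp : MeasurePreserving (Matrix.toLin' M) volume volume := ⟨hc, h1⟩
  have hmp2 := hmp.comp (PiLp.volume_preserving_ofLp (Fin 2))
  have hbox : volume (Set.Icc ![a, b] ![a + h, b + w]) = ENNReal.ofReal (h * w) := by
    rw [Real.volume_Icc_pi, Fin.prod_univ_two, ENNReal.ofReal_mul hh]
    simp
  rw [← hbox, ← hmp2.measure_preimage measurableSet_Icc.nullMeasurableSet]
  apply measure_mono
  intro x hx
  obtain ⟨⟨h1, h2⟩, h3, h4⟩ := hS x hx
  simp only [dirForm, cos_add_pi_div_two, sin_add_pi_div_two] at h1 h2 h3 h4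
  simp only [Set.mem_preimage, Set.mem_Icc, Pi.le_def, Fin.forall_fin_two, M]
  simp [Matrix.toLin'_apply, Matrix.mulVec, dotProduct, Fin.sum_univ_two]
  refine ⟨⟨?_, ?_⟩, ?_, ?_⟩ <;> linarith

lemma le_norm_coe_of_cos_le {x β : ℝ} (hβ : β ≤ π) (h : cos x ≤ cos β) :
    β ≤ ‖(x : AddCircle (2 * π))‖ := by
  rw [AddCircle.norm_eq]
  set k := round ((2 * π)⁻¹ * x)
  by_contra! hlt
  have h1 := cos_lt_cos_of_nonneg_of_le_pi (abs_nonneg _) hβ hlt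
  rw [cos_abs, cos_sub_int_mul_two_pi] at h1
  linarith

lemma card_mul_le_two_pi {s : Finset ℝ} {β ρ : ℝ} (hβ : β ≤ π) (hρ : ρ < β)
    (hs : ∀ x ∈ s, ∀ y ∈ s, x ≠ y → cos (x - y) ≤ cos β) : s.card * ρ ≤ 2 * π := by
  have : Fact (0 < 2 * π) := ⟨two_pi_pos⟩
  have hd : (s : Set ℝ).PairwiseDisjoint
      (fun x : ℝ => Metric.closedBall (x : AddCircle (2 * π)) (ρ / 2)) := by
    intro x hx y hy hxy
    apply Metric.closedBall_disjoint_closedBall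
    have := le_norm_coe_of_cos_le hβ (hs x hx y hy hxy)
    rw [dist_eq_norm, ← AddCircle.coe_sub]
    linarith
  have h := measure_biUnion_finset (μ := volume) hd
    (fun x _ => Metric.isClosed_closedBall.measurableSet)
  have h2 := measure_mono (μ := (volume : Measure (AddCircle (2 * π)))) (Set.subset_univ
    (⋃ x ∈ s, Metric.closedBall (x : AddCircle (2 * π)) (ρ / 2)))
  rw [h, AddCircle.measure_univ] at h2
  simp only [AddCircle.volume_closedBall, Finset.sum_const, nsmul_eq_mul] at h2
  have hρ' : min (2 * π) (2 * (ρ / 2)) = ρ := by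
    rw [min_eq_right] <;> linarith [pi_pos]
  rw [hρ', ← ENNReal.ofReal_natCast, ← ENNReal.ofReal_mul (by positivity)] at h2
  exact (ENNReal.ofReal_le_ofReal_iff two_pi_pos.le).1 h2

lemma exists_dirForm_eq (f : Plane →L[ℝ] ℝ) (hf : f ≠ 0) :
    ∃ ρ θ : ℝ, 0 < ρ ∧ ∀ x, f x = ρ * dirForm θ x := by
  set z : ℂ := ⟨f (EuclideanSpace.single 0 1), f (EuclideanSpace.single 1 1)⟩ with hz
  have hfx : ∀ x : Plane, f x = z.re * x 0 + z.im * x 1 := by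
    intro x
    have hx : x = x 0 • EuclideanSpace.single 0 1 + x 1 • EuclideanSpace.single 1 1 := by
      ext i; fin_cases i <;> simp
    conv_lhs => rw [hx]
    simp only [map_add, map_smul, smul_eq_mul, hz]
    ring
  have hz0 : z ≠ 0 := by
    intro h
    apply hf
    ext x
    simp [hfx, h]
  refine ⟨‖z‖, Complex.arg z, norm_pos_iff.2 hz0, fun x => ?_⟩
  rw [hfx, dirForm, ← Complex.norm_mul_cos_arg z, ← Complex.norm_mul_sin_arg z]
  simp only [Complex.norm_mul_cos_arg, Complex.norm_mul_sin_arg]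
  linear_combination x 0 * (- Complex.norm_mul_cos_arg z) + x 1 * (- Complex.norm_mul_sin_arg z)

lemma Convex.interior_nonempty_of_volume_pos {S : Set Plane} (hS : Convex ℝ S)
    (h : 0 < (volume S).toReal) : (interior S).Nonempty := by
  by_contra hne
  rw [Set.not_nonempty_iff_eq_empty] at hne
  have h0 := hS.addHaar_frontier volume
  rw [frontier, hne, Set.sdiff_empty] at h0
  simp [measure_mono_null subset_closure h0] at h

lemma closure_eq_inter_halfPlane {S Q U : Set Plane} {θ c : ℝ} (hU : Convex ℝ U)
    (hunion : S ∪ Q = U) (hne : (interior S).Nonempty)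
    (hS : ∀ x ∈ interior S, dirForm θ x < c) (hS' : ∀ x ∈ closure S, dirForm θ x ≤ c)
    (hQ : ∀ x ∈ closure Q, c ≤ dirForm θ x) :
    closure S = closure U ∩ {x | dirForm θ x ≤ c} := by
  apply Set.Subset.antisymm
  · exact fun x hx => ⟨closure_mono (hunion ▸ Set.subset_union_left) hx, hS' x hx⟩
  rintro x ⟨hx, hxc⟩
  have key : ∀ y ∈ closure U, dirForm θ y < c → y ∈ closure S := by
    intro y hy hyc
    rw [← hunion, closure_union] at hy
    exact hy.resolve_right fun h => absurd (hQ y h) (not_le.2 hyc)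
  obtain ⟨z, hz⟩ := hne
  have hzU : z ∈ closure U := subset_closure (hunion ▸ Or.inl (interior_subset hz))
  have hlim : Filter.Tendsto (fun t : ℝ => x + t • (z - x)) (nhdsWithin 0 (Set.Ioi 0)) (nhds x) := by
    have : Continuous (fun t : ℝ => x + t • (z - x)) := by fun_prop
    have h := this.tendsto 0
    simp only [zero_smul, add_zero] at h
    exact h.mono_left nhdsWithin_le_nhds
  apply isClosed_closure.mem_of_tendsto hlim
  filter_upwards [Ioo_mem_nhdsGT (zero_lt_one' ℝ)] with t ht
  apply key
  · exact hU.closure.add_smul_sub_mem hx hzU ⟨ht.1.le, ht.2.le⟩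
  · rw [dirForm_add, dirForm_smul, dirForm_sub]
    have := hS z hz
    simp only [Set.mem_ofPred_eq] at hxc
    nlinarith [ht.1, ht.2, mul_pos ht.1 (sub_pos.2 this)]

lemma dirForm_add_pi (θ : ℝ) (x : Plane) : dirForm (θ + π) x = -dirForm θ x := by
  simp [dirForm]; ring

lemma exists_halfPlane_cut {S Q U : Set Plane} (hSc : Convex ℝ S) (hQc : Convex ℝ Q)
    (hU : Convex ℝ U) (hunion : S ∪ Q = U) (hS : 0 < (volume S).toReal)
    (hQ : 0 < (volume Q).toReal) (hdisj : Disjoint (interior S) (interior Q)) :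
    ∃ θ c, closure S = closure U ∩ {x | dirForm θ x ≤ c} ∧
      closure Q = closure U ∩ {x | c ≤ dirForm θ x} := by
  have hSn := hSc.interior_nonempty_of_volume_pos hS
  have hQn := hQc.interior_nonempty_of_volume_pos hQ
  obtain ⟨f, u, h1, h2⟩ := geometric_hahn_banach_open_open hSc.interior isOpen_interior
    hQc.interior isOpen_interior hdisj
  have hf : f ≠ 0 := by
    rintro rfl
    obtain ⟨x, hx⟩ := hSn
    obtain ⟨y, hy⟩ := hQn
    have := h1 x hx
    have := h2 y hy
    simp at *
    linarith
  obtain ⟨ρ, θ, hρ, hfθ⟩ := exists_dirForm_eq f hf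
  have h1' : ∀ x ∈ interior S, dirForm θ x < u / ρ := fun x hx => by
    rw [lt_div_iff₀ hρ, mul_comm, ← hfθ]; exact h1 x hx
  have h2' : ∀ x ∈ interior Q, u / ρ < dirForm θ x := fun x hx => by
    rw [div_lt_iff₀ hρ, mul_comm, ← hfθ]; exact h2 x hx
  have h3 : ∀ x ∈ closure S, dirForm θ x ≤ u / ρ := by
    rw [← hSc.closure_interior_eq_closure_of_nonempty_interior hSn]
    exact fun x hx => closure_minimal (fun y hy => (h1' y hy).le)
      (isClosed_le (continuous_dirForm θ) continuous_const) hx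
  have h4 : ∀ x ∈ closure Q, u / ρ ≤ dirForm θ x := by
    rw [← hQc.closure_interior_eq_closure_of_nonempty_interior hQn]
    exact fun x hx => closure_minimal (fun y hy => (h2' y hy).le)
      (isClosed_le continuous_const (continuous_dirForm θ)) hx
  refine ⟨θ, u / ρ, closure_eq_inter_halfPlane hU hunion hSn h1' h3 h4, ?_⟩
  have h5 := closure_eq_inter_halfPlane (θ := θ + π) (c := -(u / ρ)) hU
    (Set.union_comm S Q ▸ hunion) hQn
    (fun x hx => by rw [dirForm_add_pi]; exact neg_lt_neg (h2' x hx))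
    (fun x hx => by rw [dirForm_add_pi]; exact neg_le_neg (h4 x hx))
    (fun x hx => by rw [dirForm_add_pi]; exact neg_le_neg (h3 x hx))
  simpa only [dirForm_add_pi, neg_le_neg_iff] using h5

/-- The centre of the unit square. -/
noncomputable def squareCenter : Plane := !₂[1 / 2, 1 / 2]

/-- `K` is the polygon cut out of the plane by the half-planes `dirForm θ x ≤ c`, `(θ, c) ∈ N`,
where distinct normal directions are at least `β` apart, every half-plane contributes an edge of
length at least `ℓ`, and the disc of radius `r` about the centre of the square is kept. -/
structure IsFatPolygon (β ℓ r : ℝ) (N : Finset (ℝ × ℝ)) (K : Set Plane) : Prop where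
  mem_iff : ∀ x, x ∈ K ↔ ∀ p ∈ N, dirForm p.1 x ≤ p.2
  sep : ∀ p ∈ N, ∀ q ∈ N, p ≠ q → cos (p.1 - q.1) ≤ cos β
  edge : ∀ p ∈ N, ∃ x ∈ K, ∃ y ∈ K, dirForm p.1 x = p.2 ∧ dirForm p.1 y = p.2 ∧ ℓ ≤ dist x y
  disc : ∀ p ∈ N, dirForm p.1 squareCenter + r ≤ p.2

/-- If `θ`, `φ`, `ψ` are directions with `φ` closer to `θ` than `ψ` and on the same side, then a
point beyond both lines through `q` normal to `θ` and `ψ` is not beyond the one normal to `φ`. -/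
lemma dirForm_lt_of_between {θ φ ψ : ℝ} {x q : Plane} (hφ : 0 < cos (φ - θ))
    (hψ : cos (ψ - θ) ≤ cos (φ - θ)) (hside : 0 < sin (φ - θ) * sin (ψ - θ))
    (h1 : dirForm θ x ≤ dirForm θ q) (h2 : dirForm ψ x < dirForm ψ q) :
    dirForm φ x < dirForm φ q := by
  rw [dirForm_eq θ ψ x, dirForm_eq θ ψ q] at h2
  rw [dirForm_eq θ φ x, dirForm_eq θ φ q]
  have e1 := sin_sq_add_cos_sq (φ - θ)
  have e2 := sin_sq_add_cos_sq (ψ - θ)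
  generalize dirForm θ x = X at *
  generalize dirForm θ q = X' at *
  generalize dirForm (θ + π / 2) x = Y at *
  generalize dirForm (θ + π / 2) q = Y' at *
  generalize cos (φ - θ) = a at *
  generalize sin (φ - θ) = s at *
  generalize cos (ψ - θ) = b at *
  generalize sin (ψ - θ) = S at *
  have hs : 0 < s ^ 2 := by
    have : s ≠ 0 := by rintro rfl; simp at hside
    positivity
  have key : 0 ≤ (s * S) * a - b * s ^ 2 := by
    rcases le_or_gt b 0 with hb | hb
    · nlinarith [mul_pos hside hφ, mul_nonneg (neg_nonneg.2 hb) hs.le]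
    · have hsq : s ^ 2 ≤ S ^ 2 := by nlinarith
      have : s ^ 2 ≤ s * S := by
        apply le_of_sq_le_sq _ hside.le
        nlinarith
      nlinarith [mul_le_mul_of_nonneg_right this hφ.le, mul_le_mul_of_nonneg_right hψ hs.le]
  have h3 : 0 < s ^ 2 * ((b * X' + S * Y') - (b * X + S * Y)) := mul_pos hs (sub_pos.2 h2)
  have h4 : 0 ≤ ((s * S) * a - b * s ^ 2) * (X' - X) := mul_nonneg key (sub_nonneg.2 h1)
  have h5 : 0 < (s * S) * ((a * X' + s * Y') - (a * X + s * Y)) := by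
    linear_combination h3 + h4
  linarith [(mul_pos_iff_of_pos_left hside).1 h5]

/-- A region between the lines normal to `θ` and `φ` through one of its points is thin. -/
lemma volume_le_of_wedge {θ φ D : ℝ} {C : Set Plane} {q : Plane} (hcos : 0 < cos (φ - θ))
    (hdiam : ∀ x ∈ C, ∀ y ∈ C, dist x y ≤ D) (hq : q ∈ C)
    (hθ : ∀ x ∈ C, dirForm θ x ≤ dirForm θ q) (hφ : ∀ x ∈ C, dirForm φ q ≤ dirForm φ x)
    (hs0 : sin (φ - θ) ≠ 0) :
    volume C ≤ ENNReal.ofReal (|sin (φ - θ)| * D * D) := by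
  have hD : 0 ≤ D := dist_nonneg.trans (hdiam q hq q hq)
  set s := sin (φ - θ) with hs
  apply volume_le_of_dirForm_mem_Icc (θ := θ) (a := dirForm θ q - |s| * D)
    (b := if 0 < s then dirForm (θ + π / 2) q else dirForm (θ + π / 2) q - D) _ (by positivity)
  intro x hx
  have h1 := hθ x hx
  have h2 := hφ x hx
  have h3 := dirForm_sq_add_sq θ x q
  have h4 : dist x q ^ 2 ≤ D ^ 2 := pow_le_pow_left₀ dist_nonneg (hdiam x hx q hq) 2
  have h5 := abs_le.1 ((abs_dirForm_sub_le (θ + π / 2) x q).trans (hdiam x hx q hq))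
  rw [dirForm_eq θ φ x, dirForm_eq θ φ q, ← hs] at h2
  have e1 := sin_sq_add_cos_sq (φ - θ)
  rw [← hs] at e1
  generalize cos (φ - θ) = a at *
  have h6 : 0 ≤ s * (dirForm (θ + π / 2) x - dirForm (θ + π / 2) q) := by
    nlinarith [mul_nonneg hcos.le (sub_nonneg.2 h1)]
  have h7 : (dirForm θ q - dirForm θ x) ^ 2 ≤ (|s| * D) ^ 2 := by
    have : (a * (dirForm θ q - dirForm θ x)) ^ 2
        ≤ (s * (dirForm (θ + π / 2) x - dirForm (θ + π / 2) q)) ^ 2 :=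
      pow_le_pow_left₀ (mul_nonneg hcos.le (sub_nonneg.2 h1)) (by linarith) 2
    rw [mul_pow, sq_abs]
    nlinarith [mul_le_mul_of_nonneg_left h4 (sq_nonneg s)]
  have h8 := abs_le_of_sq_le_sq' h7 (by positivity)
  refine ⟨⟨by linarith [h8.2], by linarith⟩, ?_⟩
  split_ifs with h
  · have := nonneg_of_mul_nonneg_right h6 h
    constructor <;> linarith [h5.2]
  · have h' : s < 0 := lt_of_le_of_ne (not_lt.1 h) hs0
    have : dirForm (θ + π / 2) x - dirForm (θ + π / 2) q ≤ 0 := by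
      by_contra! hc
      nlinarith [mul_neg_of_neg_of_pos h' hc]
    constructor <;> linarith [h5.1]

namespace IsFatPolygon

variable {β ℓ r D ε φ c : ℝ} {N : Finset (ℝ × ℝ)} {K : Set Plane}

lemma cos_sub_le (h : IsFatPolygon β ℓ r N K) (hβ0 : 0 < β) (hβ : β < π / 2)
    (hdiam : ∀ x ∈ K, ∀ y ∈ K, c ≤ dirForm φ x → c ≤ dirForm φ y → dist x y ≤ D) (hD : D < ℓ)
    (hvol : ENNReal.ofReal ε ≤ volume (K ∩ {x | c ≤ dirForm φ x})) (hε : sin β * D * D < ε)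
    (hε0 : 0 < ε) {p : ℝ × ℝ} (hp : p ∈ N) : cos (φ - p.1) ≤ cos β := by
  by_contra! hlt
  have hcβ : 0 < cos β := cos_pos_of_mem_Ioo ⟨by linarith, hβ⟩
  have hcos : 0 < cos (φ - p.1) := hcβ.trans hlt
  obtain ⟨x, hx, y, hy, hxp, hyp, hxy⟩ := h.edge p hp
  obtain ⟨z, hzK, hz⟩ : (K ∩ {x | c ≤ dirForm φ x}).Nonempty := by
    apply nonempty_of_measure_ne_zero (μ := volume)
    exact ((ENNReal.ofReal_pos.2 hε0).trans_le hvol).ne'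
  have hzp := (h.mem_iff z).1 hzK p hp
  obtain ⟨e, he, hep, hec⟩ : ∃ e ∈ K, dirForm p.1 e = p.2 ∧ dirForm φ e < c := by
    by_contra! hno
    linarith [hdiam x hx y hy (hno x hx hxp) (hno y hy hyp)]
  have e1 := sin_sq_add_cos_sq (φ - p.1)
  have hs0 : sin (φ - p.1) ≠ 0 := by
    intro hs
    have h1 : cos (φ - p.1) = 1 := by
      rw [hs] at e1; nlinarith
    have h2 : dirForm φ e = dirForm p.1 e := by rw [dirForm_eq p.1 φ e, h1, hs]; ring
    have h3 : dirForm φ z = dirForm p.1 z := by rw [dirForm_eq p.1 φ z, h1, hs]; ring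
    simp only [Set.mem_ofPred_eq] at hz
    linarith
  obtain ⟨q, hqp, hqc⟩ : ∃ q, dirForm p.1 q = p.2 ∧ dirForm φ q = c := by
    refine ⟨framePoint p.1 p.2 ((c - p.2 * cos (φ - p.1)) / sin (φ - p.1)), ?_, ?_⟩
    · rw [dirForm_framePoint]; simp
    · rw [dirForm_framePoint]; field_simp; ring
  have hqK : q ∈ K := by
    rw [h.mem_iff]
    by_contra! hno
    obtain ⟨j, hj, hjq⟩ := hno
    have hjp : j ≠ p := by rintro rfl; linarith
    have hej := (h.mem_iff e).1 he j hj
    have hzj := (h.mem_iff z).1 hzK j hj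
    have hsep := h.sep j hj p hp hjp
    have hside : 0 < sin (φ - p.1) * sin (j.1 - p.1) := by
      have h1 : 0 < sin (φ - p.1) * (dirForm (p.1 + π / 2) q - dirForm (p.1 + π / 2) e) := by
        rw [← hqc, dirForm_eq p.1 φ e, dirForm_eq p.1 φ q, hqp, hep] at hec
        linarith
      have h2 : 0 < sin (j.1 - p.1) * (dirForm (p.1 + π / 2) q - dirForm (p.1 + π / 2) e) := by
        have := hej.trans_lt hjq
        rw [dirForm_eq p.1 j.1 e, dirForm_eq p.1 j.1 q, hqp, hep] at this
        linarith
      generalize dirForm (p.1 + π / 2) q - dirForm (p.1 + π / 2) e = t at *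
      have ht : 0 < t ^ 2 := by
        have : t ≠ 0 := by rintro rfl; simp at h1
        positivity
      have := mul_pos h1 h2
      have h3 : 0 < (sin (φ - p.1) * sin (j.1 - p.1)) * t ^ 2 := by linarith
      exact (mul_pos_iff_of_pos_right ht).1 h3
    have := dirForm_lt_of_between hcos (hsep.trans hlt.le) hside
      (hzp.trans hqp.ge) (hzj.trans_lt hjq)
    simp only [Set.mem_ofPred_eq] at hz
    linarith
  have hv := volume_le_of_wedge (θ := p.1) (φ := φ) (D := D)
    (C := K ∩ {x | c ≤ dirForm φ x}) (q := q) hcos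
    (fun x hx y hy => hdiam x hx.1 y hy.1 hx.2 hy.2) ⟨hqK, hqc.ge⟩
    (fun x hx => ((h.mem_iff x).1 hx.1 p hp).trans hqp.ge) (fun x hx => hqc.le.trans hx.2) hs0
  have hle := hvol.trans hv
  have hsin : |sin (φ - p.1)| ≤ sin β := by
    apply abs_le_of_sq_le_sq _ (sin_nonneg_of_nonneg_of_le_pi hβ0.le (by linarith))
    have e2 := sin_sq_add_cos_sq β
    nlinarith
  have hD2 : 0 ≤ D * D := mul_self_nonneg D
  rw [ENNReal.ofReal_le_ofReal_iff (by rw [mul_assoc]; positivity)] at hle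
  nlinarith [mul_le_mul_of_nonneg_right hsin hD2]

lemma convex (h : IsFatPolygon β ℓ r N K) : Convex ℝ K := by
  intro x hx y hy a b ha hb hab
  rw [h.mem_iff] at *
  intro p hp
  rw [dirForm_add, dirForm_smul, dirForm_smul]
  have hb' : b = 1 - a := by linarith
  subst hb'
  nlinarith [mul_le_mul_of_nonneg_left (hx p hp) ha, mul_le_mul_of_nonneg_left (hy p hp) hb]

lemma center_add_framePoint_mem (h : IsFatPolygon β ℓ r N K) (θ : ℝ) {a : ℝ} (ha : |a| ≤ r) :
    squareCenter + framePoint θ a 0 ∈ K := by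
  rw [h.mem_iff]
  intro p hp
  rw [dirForm_add, dirForm_framePoint]
  have h1 := h.disc p hp
  have h2 : |a * cos (p.1 - θ)| ≤ r := by
    rw [abs_mul]
    exact (mul_le_of_le_one_right (abs_nonneg a) (abs_cos_le_one _)).trans ha
  linarith [le_abs_self (a * cos (p.1 - θ))]

lemma disc_cut (h : IsFatPolygon β ℓ r N K)
    (hdiam : ∀ x ∈ K, ∀ y ∈ K, c ≤ dirForm φ x → c ≤ dirForm φ y → dist x y ≤ D)
    (hD0 : 0 < D) (hDr : D < r) : dirForm φ squareCenter + (r - D) ≤ c := by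
  by_contra! hlt
  have hval : ∀ a, dirForm φ (squareCenter + framePoint φ a 0) = dirForm φ squareCenter + a := by
    intro a; rw [dirForm_add, dirForm_framePoint]; simp
  set a := max (c - dirForm φ squareCenter) 0 with ha
  have ha1 : a < r - D := max_lt (by linarith) (by linarith)
  have ha0 : 0 ≤ a := le_max_right _ _
  have ha2 : c - dirForm φ squareCenter ≤ a := le_max_left _ _
  have h1 := h.center_add_framePoint_mem φ (a := r) (by rw [abs_of_pos]; linarith)
  have h2 := h.center_add_framePoint_mem φ (a := a) (by rw [abs_of_nonneg ha0]; linarith)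
  have h3 := hdiam _ h1 _ h2 (by rw [hval]; linarith) (by rw [hval]; linarith)
  have h4 := (le_abs_self _).trans (abs_dirForm_sub_le φ
    (squareCenter + framePoint φ r 0) (squareCenter + framePoint φ a 0))
  rw [hval, hval] at h4
  linarith

lemma exists_dirForm_gt {C : Set Plane} {H : ℝ}
    (hdiam : ∀ x ∈ C, ∀ y ∈ C, dist x y ≤ D) (hc : ∀ x ∈ C, c ≤ dirForm φ x)
    (hvol : ENNReal.ofReal ε ≤ volume C) (hε0 : 0 < ε) (hH : 0 ≤ H) (hε : H * (2 * D) < ε) :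
    ∃ x ∈ C, c + H < dirForm φ x := by
  by_contra! hno
  obtain ⟨z, hz⟩ : C.Nonempty := by
    apply nonempty_of_measure_ne_zero (μ := volume)
    exact ((ENNReal.ofReal_pos.2 hε0).trans_le hvol).ne'
  have hv := volume_le_of_dirForm_mem_Icc (S := C) (θ := φ) (a := c) (h := H)
    (b := dirForm (φ + π / 2) z - D) (w := 2 * D) (fun x hx => by
      have := abs_le.1 ((abs_dirForm_sub_le (φ + π / 2) x z).trans (hdiam x hx z hz))
      exact ⟨⟨hc x hx, hno x hx⟩, by linarith, by linarith⟩) hH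
  have hD : 0 ≤ D := dist_nonneg.trans (hdiam z hz z hz)
  have := hvol.trans hv
  rw [ENNReal.ofReal_le_ofReal_iff (by positivity)] at this
  linarith

lemma exists_chord (h : IsFatPolygon β ℓ r N K) {p : Plane} {H : ℝ} (hp : p ∈ K)
    (hpH : c + H < dirForm φ p) (hH : 0 ≤ H) (hr : 0 ≤ r) (hc : dirForm φ squareCenter ≤ c)
    (hdist : dist p squareCenter ≤ 1) :
    ∃ x ∈ K, ∃ y ∈ K, dirForm φ x = c ∧ dirForm φ y = c ∧ 2 * r * H ≤ dist x y := by
  set o := squareCenter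
  have hle := (le_abs_self _).trans ((abs_dirForm_sub_le φ p o).trans hdist)
  have hpos : 0 < dirForm φ p - dirForm φ o := by linarith
  set μ := (dirForm φ p - c) / (dirForm φ p - dirForm φ o) with hμ
  have hμm : μ * (dirForm φ p - dirForm φ o) = dirForm φ p - c := div_mul_cancel₀ _ hpos.ne'
  have hμ0 : 0 ≤ μ := div_nonneg (by linarith) hpos.le
  have hμ1 : μ ≤ 1 := (div_le_one hpos).2 (by linarith)
  have hμH : H ≤ μ := by nlinarith [mul_le_mul_of_nonneg_left hle hμ0]
  have hr' : |r| ≤ r := (abs_of_nonneg hr).le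
  have hm1 := h.center_add_framePoint_mem (φ + π / 2) (a := r) hr'
  have hm2 := h.center_add_framePoint_mem (φ + π / 2) (a := -r) (by rwa [abs_neg])
  have hval : ∀ a, dirForm φ (p + μ • (o + framePoint (φ + π / 2) a 0 - p)) = c := by
    intro a
    rw [dirForm_add, dirForm_smul, dirForm_sub, dirForm_add, dirForm_framePoint]
    simp
    linarith
  refine ⟨_, h.convex.add_smul_sub_mem hp hm1 ⟨hμ0, hμ1⟩,
    _, h.convex.add_smul_sub_mem hp hm2 ⟨hμ0, hμ1⟩, hval r, hval (-r), ?_⟩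
  refine le_trans ?_ ((le_abs_self _).trans (abs_dirForm_sub_le (φ + π / 2) _ _))
  simp only [dirForm_add (φ + π / 2), dirForm_smul, dirForm_sub, dirForm_framePoint]
  simp
  nlinarith [mul_le_mul_of_nonneg_left hμH hr]

lemma exists_edge_cut_of_le (hK : Convex ℝ K)
    (hdiam : ∀ x ∈ K, ∀ y ∈ K, c ≤ dirForm φ x → c ≤ dirForm φ y → dist x y ≤ D)
    (hD0 : 0 ≤ D) (hD : D < ℓ) {θ b : ℝ} {x y : Plane} (hx : x ∈ K) (hy : y ∈ K) (hxb : dirForm θ x = b)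
    (hyb : dirForm θ y = b) (hxy : ℓ ≤ dist x y) (hle : dirForm φ y ≤ dirForm φ x) :
    ∃ x' ∈ K, dirForm φ x' ≤ c ∧ dirForm φ y ≤ c ∧ dirForm θ x' = b ∧ ℓ - D ≤ dist x' y := by
  have hyc : dirForm φ y < c := by
    by_contra! hyc
    linarith [hdiam x hx y hy (hyc.trans hle) hyc]
  rcases le_or_gt (dirForm φ x) c with hxc | hxc
  · exact ⟨x, hx, hxc, hyc.le, hxb, by linarith⟩
  · have hpos : 0 < dirForm φ x - dirForm φ y := by linarith
    set μ := (dirForm φ x - c) / (dirForm φ x - dirForm φ y) with hμ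
    have hμm : μ * (dirForm φ x - dirForm φ y) = dirForm φ x - c := div_mul_cancel₀ _ hpos.ne'
    have hμ0 : 0 ≤ μ := div_nonneg (by linarith) hpos.le
    have hμ1 : μ ≤ 1 := (div_le_one hpos).2 (by linarith)
    have hq := hK.add_smul_sub_mem hx hy ⟨hμ0, hμ1⟩
    have hqc : dirForm φ (x + μ • (y - x)) = c := by
      rw [dirForm_add, dirForm_smul, dirForm_sub]; linarith
    refine ⟨_, hq, hqc.le, hyc.le, ?_, ?_⟩
    · rw [dirForm_add, dirForm_smul, dirForm_sub, hxb, hyb]; ring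
    · have h1 := hdiam x hx _ hq hxc.le hqc.ge
      linarith [dist_triangle x (x + μ • (y - x)) y]

lemma exists_edge_cut (hK : Convex ℝ K)
    (hdiam : ∀ x ∈ K, ∀ y ∈ K, c ≤ dirForm φ x → c ≤ dirForm φ y → dist x y ≤ D)
    (hD0 : 0 ≤ D) (hD : D < ℓ) {θ b : ℝ} {x y : Plane} (hx : x ∈ K) (hy : y ∈ K)
    (hxb : dirForm θ x = b) (hyb : dirForm θ y = b) (hxy : ℓ ≤ dist x y) :
    ∃ x' ∈ K ∩ {x | dirForm φ x ≤ c}, ∃ y' ∈ K ∩ {x | dirForm φ x ≤ c},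
      dirForm θ x' = b ∧ dirForm θ y' = b ∧ ℓ - D ≤ dist x' y' := by
  rcases le_total (dirForm φ y) (dirForm φ x) with hle | hle
  · obtain ⟨x', h1, h2, h3, h4, h5⟩ :=
      exists_edge_cut_of_le hK hdiam hD0 hD hx hy hxb hyb hxy hle
    exact ⟨x', ⟨h1, h2⟩, y, ⟨hy, h3⟩, h4, hyb, h5⟩
  · obtain ⟨x', h1, h2, h3, h4, h5⟩ :=
      exists_edge_cut_of_le hK hdiam hD0 hD hy hx hyb hxb (dist_comm x y ▸ hxy) hle
    exact ⟨x', ⟨h1, h2⟩, x, ⟨hx, h3⟩, h4, hxb, h5⟩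

/-- Cutting a small fat piece off a fat polygon adds a new direction and keeps the polygon fat. -/
theorem cut (h : IsFatPolygon β ℓ r N K) {H ℓ' r' : ℝ} (hβ0 : 0 < β) (hβ : β < π / 2)
    (hK : ∀ x ∈ K, dist x squareCenter ≤ 1)
    (hdiam : ∀ x ∈ K, ∀ y ∈ K, c ≤ dirForm φ x → c ≤ dirForm φ y → dist x y ≤ D)
    (hD0 : 0 < D) (hDr : D < r) (hDℓ : D < ℓ)
    (hvol : ENNReal.ofReal ε ≤ volume (K ∩ {x | c ≤ dirForm φ x}))
    (hε : sin β * D * D < ε) (hε0 : 0 < ε) (hH : 0 ≤ H) (hHε : H * (2 * D) < ε)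
    (hℓ' : ℓ' ≤ ℓ - D) (hℓH : ℓ' ≤ 2 * r * H) (hr' : r' ≤ r - D) :
    ∃ N', N'.card = N.card + 1 ∧ IsFatPolygon β ℓ' r' N' (K ∩ {x | dirForm φ x ≤ c}) := by
  have hsep : ∀ p ∈ N, cos (φ - p.1) ≤ cos β := fun p hp =>
    h.cos_sub_le hβ0 hβ hdiam hDℓ hvol hε hε0 hp
  have hcβ : cos β < 1 := by
    rw [← cos_zero]
    exact cos_lt_cos_of_nonneg_of_le_pi le_rfl (by linarith) hβ0
  have hnew : (φ, c) ∉ N := fun hmem => by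
    have := hsep _ hmem
    rw [sub_self, cos_zero] at this
    linarith
  have hdisc := h.disc_cut hdiam hD0 hDr
  refine ⟨insert (φ, c) N, Finset.card_insert_of_notMem hnew, ⟨?_, ?_, ?_, ?_⟩⟩
  · intro x
    rw [Finset.forall_mem_insert, and_comm, ← h.mem_iff]
    rfl
  · intro p hp q hq hpq
    rw [Finset.mem_insert] at hp hq
    rcases hp with rfl | hp <;> rcases hq with rfl | hq
    · exact absurd rfl hpq
    · exact hsep q hq
    · rw [← cos_neg, neg_sub]; exact hsep p hp
    · exact h.sep p hp q hq hpq
  · rw [Finset.forall_mem_insert]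
    constructor
    · obtain ⟨p, hp, hpH⟩ := exists_dirForm_gt (φ := φ) (c := c)
        (C := K ∩ {x | c ≤ dirForm φ x}) (fun x hx y hy => hdiam x hx.1 y hy.1 hx.2 hy.2)
        (fun x hx => hx.2) hvol hε0 hH hHε
      obtain ⟨x, hx, y, hy, hxc, hyc, hxy⟩ := h.exists_chord hp.1 hpH hH (hD0.trans hDr).le
        (by linarith) (hK p hp.1)
      exact ⟨x, ⟨hx, hxc.le⟩, y, ⟨hy, hyc.le⟩, hxc, hyc, hℓH.trans hxy⟩
    · intro p hp
      obtain ⟨x, hx, y, hy, hxp, hyp, hxy⟩ := h.edge p hp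
      obtain ⟨x', hx', y', hy', h1, h2, h3⟩ :=
        exists_edge_cut h.convex hdiam hD0.le hDℓ hx hy hxp hyp hxy
      exact ⟨x', hx', y', hy', h1, h2, hℓ'.trans h3⟩
  · rw [Finset.forall_mem_insert]
    exact ⟨by linarith, fun p hp => by linarith [h.disc p hp]⟩

lemma mono (h : IsFatPolygon β ℓ r N K) {ℓ' r' : ℝ} (hℓ : ℓ' ≤ ℓ) (hr : r' ≤ r) :
    IsFatPolygon β ℓ' r' N K :=
  ⟨h.mem_iff, h.sep, fun p hp => by
    obtain ⟨x, hx, y, hy, h1, h2, h3⟩ := h.edge p hp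
    exact ⟨x, hx, y, hy, h1, h2, hℓ.trans h3⟩, fun p hp => by linarith [h.disc p hp]⟩

/-- The number of directions of a fat polygon is bounded. -/
lemma card_mul_le (h : IsFatPolygon β ℓ r N K) (hβ0 : 0 < β) (hβ : β ≤ π) {ρ : ℝ}
    (hρ : ρ < β) : N.card * ρ ≤ 2 * π := by
  have hcβ : cos β < 1 := by
    rw [← cos_zero]
    exact cos_lt_cos_of_nonneg_of_le_pi le_rfl hβ hβ0
  have hinj : Set.InjOn Prod.fst (N : Set (ℝ × ℝ)) := by
    intro p hp q hq hpq
    by_contra hne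
    have := h.sep p hp q hq hne
    rw [hpq, sub_self, cos_zero] at this
    linarith
  rw [← Finset.card_image_of_injOn hinj]
  refine card_mul_le_two_pi hβ hρ ?_
  intro x hx y hy hxy
  obtain ⟨p, hp, rfl⟩ := Finset.mem_image.1 hx
  obtain ⟨q, hq, rfl⟩ := Finset.mem_image.1 hy
  exact h.sep p hp q hq (fun e => hxy (e ▸ rfl))

end IsFatPolygon

lemma exists_isFatPolygon_unitSquare {β : ℝ} (hβ0 : 0 < β) (hβ : β < π / 2) :
    ∃ N : Finset (ℝ × ℝ), N.card = 4 ∧ IsFatPolygon β 1 (1 / 2) N unitSquare := by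
  have hcβ : 0 < cos β := cos_pos_of_mem_Ioo ⟨by linarith, hβ⟩
  have hπ := pi_pos
  have h0 : ∀ x, dirForm 0 x = x 0 := fun x => by simp [dirForm]
  have h1 : ∀ x, dirForm (π / 2) x = x 1 := fun x => by simp [dirForm]
  have h2 : ∀ x, dirForm π x = -x 0 := fun x => by simp [dirForm]
  have h3 : ∀ x, dirForm (-(π / 2)) x = -x 1 := fun x => by simp [dirForm]
  have hc1 : cos (-(π / 2) - π) = 0 := by rw [cos_sub_pi]; simp
  have hc2 : cos (-(π / 2) - π / 2) = -1 := by
    rw [show -(π / 2) - π / 2 = -π by ring]; simp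
  refine ⟨{(0, 1), (π / 2, 1), (π, 0), (-(π / 2), 0)}, ?_, ⟨?_, ?_, ?_, ?_⟩⟩
  · have e0 : 0 ≠ π / 2 := by linarith
    have e1 : π / 2 ≠ π := by linarith
    have e2 : π / 2 ≠ -(π / 2) := by linarith
    have e3 : π ≠ -(π / 2) := by linarith
    rw [Finset.card_insert_of_notMem, Finset.card_insert_of_notMem,
      Finset.card_insert_of_notMem, Finset.card_singleton] <;>
    simp [e0, e1, e2, e3, pi_ne_zero]
  · intro x
    simp only [Finset.forall_mem_insert, Finset.mem_singleton, forall_eq, h0, h1, h2, h3,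
      unitSquare, Set.mem_ofPred_eq, Set.mem_Icc]
    constructor
    · rintro ⟨⟨_, _⟩, _, _⟩; refine ⟨?_, ?_, ?_, ?_⟩ <;> linarith
    · rintro ⟨_, _, _, _⟩; refine ⟨⟨?_, ?_⟩, ?_, ?_⟩ <;> linarith
  · have hsymm : ∀ a b : ℝ, cos (a - b) ≤ cos β → cos (b - a) ≤ cos β := fun a b h => by
      rwa [← cos_neg, neg_sub]
    have k1 : cos (0 - π / 2) ≤ cos β := by simpa using hcβ.le
    have k2 : cos (0 - π) ≤ cos β := by simp; linarith
    have k3 : cos (0 - -(π / 2)) ≤ cos β := by simpa using hcβ.le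
    have k4 : cos (π / 2 - π) ≤ cos β := by simpa using hcβ.le
    have k5 : cos (-(π / 2) - π / 2) ≤ cos β := by rw [hc2]; linarith
    have k6 : cos (-(π / 2) - π) ≤ cos β := by rw [hc1]; exact hcβ.le
    intro p hp q hq hpq
    simp only [Finset.mem_insert, Finset.mem_singleton] at hp hq
    rcases hp with rfl | rfl | rfl | rfl <;> rcases hq with rfl | rfl | rfl | rfl <;>
      first
        | exact absurd rfl hpq
        | assumption
        | (apply hsymm; assumption)
  · have hm : ∀ a b : ℝ, 0 ≤ a → a ≤ 1 → 0 ≤ b → b ≤ 1 → !₂[a, b] ∈ unitSquare :=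
      fun a b ha ha' hb hb' => ⟨⟨ha, ha'⟩, hb, hb'⟩
    have m00 := hm 0 0 (by norm_num) (by norm_num) (by norm_num) (by norm_num)
    have m01 := hm 0 1 (by norm_num) (by norm_num) (by norm_num) (by norm_num)
    have m10 := hm 1 0 (by norm_num) (by norm_num) (by norm_num) (by norm_num)
    have m11 := hm 1 1 (by norm_num) (by norm_num) (by norm_num) (by norm_num)
    simp only [Finset.forall_mem_insert, Finset.mem_singleton, forall_eq, h0, h1, h2, h3]
    refine ⟨⟨_, m10, _, m11, ?_⟩, ⟨_, m01, _, m11, ?_⟩, ⟨_, m00, _, m01, ?_⟩,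
      ⟨_, m00, _, m10, ?_⟩⟩ <;> simp [EuclideanSpace.dist_eq]
  · simp only [Finset.forall_mem_insert, Finset.mem_singleton, forall_eq, h0, h1, h2, h3,
      squareCenter]
    norm_num

lemma dist_squareCenter_le {x : Plane} (hx : x ∈ unitSquare) : dist x squareCenter ≤ 1 := by
  obtain ⟨⟨h1, h2⟩, h3, h4⟩ := hx
  rw [EuclideanSpace.dist_eq]
  refine Real.sqrt_le_iff.2 ⟨zero_le_one, ?_⟩
  simp only [squareCenter, Fin.sum_univ_two, Real.dist_eq, sq_abs]
  simp
  nlinarith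

lemma isClosed_unitSquare : IsClosed unitSquare := by
  have h0 : Continuous fun x : Plane => x 0 := by fun_prop
  have h1 : Continuous fun x : Plane => x 1 := by fun_prop
  exact (isClosed_Icc.preimage h0).inter (isClosed_Icc.preimage h1)

lemma isBounded_unitSquare : Bornology.IsBounded unitSquare :=
  Metric.isBounded_closedBall.subset fun _ hx => Metric.mem_closedBall.2 (dist_squareCenter_le hx)

lemma exists_angle_sin_lt {α : ℝ} (h0 : 0 < α) (h : α < π / 2) :
    ∃ β, α < β ∧ β < π / 2 ∧ sin β < α := by
  have h1 : ∀ᶠ x in nhds α, sin x < α :=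
    continuous_sin.continuousAt.eventually_lt continuousAt_const (sin_lt h0)
  obtain ⟨β, ⟨h2, h3⟩, h4⟩ := ((h1.and (eventually_lt_nhds h)).filter_mono
    (nhdsWithin_le_nhds (s := Set.Ioi α))).and self_mem_nhdsWithin |>.exists
  exact ⟨β, h4, h3, h2⟩

/-- The diameter allowed to the `k`-th piece cut off. -/
noncomputable def cutDiam (d k : ℕ) : ℝ := (1 / (16 * ((d : ℝ) + 4))) ^ (k + 1)

/-- The area of the `k`-th piece cut off. -/
noncomputable def cutArea (d k : ℕ) : ℝ := cutDiam d k ^ 2 / (((d : ℝ) + 4) / (2 * π))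

lemma cutDiam_pos (d k : ℕ) : 0 < cutDiam d k := by unfold cutDiam; positivity

lemma cutArea_pos (d k : ℕ) : 0 < cutArea d k := by
  have := cutDiam_pos d k
  unfold cutArea; positivity

lemma cutDiam_succ (d k : ℕ) :
    cutDiam d (k + 1) = 1 / (16 * ((d : ℝ) + 4)) * cutDiam d k := by
  unfold cutDiam; rw [pow_succ _ (k + 1), mul_comm]

lemma cutDiam_zero_le (d : ℕ) : cutDiam d 0 ≤ 1 / 64 := by
  unfold cutDiam
  rw [zero_add, pow_one]
  apply one_div_le_one_div_of_le (by norm_num)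
  have : (0 : ℝ) ≤ d := Nat.cast_nonneg d
  linarith

lemma cutDiam_succ_le (d k : ℕ) : cutDiam d (k + 1) ≤ 1 / 64 * cutDiam d k := by
  rw [cutDiam_succ]
  have h := cutDiam_zero_le d
  unfold cutDiam at h
  rw [zero_add, pow_one] at h
  exact mul_le_mul_of_nonneg_right h (cutDiam_pos d k).le

lemma cutDiam_le (d k : ℕ) : cutDiam d k ≤ 1 / 64 := by
  induction k with
  | zero => exact cutDiam_zero_le d
  | succ k ih => linarith [cutDiam_succ_le d k]

lemma cutArea_le (d k : ℕ) : cutArea d k ≤ cutDiam d k / 32 := by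
  unfold cutArea
  have h := cutDiam_le d k
  have h0 := cutDiam_pos d k
  have hd : (0 : ℝ) ≤ d := Nat.cast_nonneg d
  have hA : (1 / 2 : ℝ) ≤ ((d : ℝ) + 4) / (2 * π) := by
    rw [le_div_iff₀ two_pi_pos]
    linarith [pi_le_four]
  rw [div_le_iff₀ (by linarith)]
  nlinarith

lemma sum_cutArea_le (d k : ℕ) :
    ∑ i ∈ Finset.range k, cutArea d i ≤ 1 / 2 - cutDiam d k := by
  induction k with
  | zero => simp; linarith [cutDiam_zero_le d]
  | succ k ih =>
    rw [Finset.sum_range_succ]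
    linarith [cutArea_le d k, cutDiam_succ_le d k, cutDiam_pos d k]

/-- Successive convex cuts of pieces of the prescribed areas off the unit square cannot all have
aspect ratio below `(d + 4) / (2π)`. -/
theorem exists_le_aspectRatio_of_cuts {d : ℕ} (hd : 1 ≤ d) {S Q : ℕ → Set Plane}
    (hS0 : S 0 = unitSquare) (hS : ∀ k ≤ d, Convex ℝ (S k)) (hQ : ∀ k < d, Convex ℝ (Q k))
    (hunion : ∀ k < d, S (k + 1) ∪ Q k = S k)
    (hdisj : ∀ k < d, Disjoint (interior (S (k + 1))) (interior (Q k)))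
    (hSvol : ∀ k ≤ d, 0 < (volume (S k)).toReal)
    (hQvol : ∀ k < d, (volume (Q k)).toReal = cutArea d k) :
    ∃ k < d, ((d : ℝ) + 4) / (2 * π) ≤ Metric.diam (Q k) ^ 2 / (volume (Q k)).toReal := by
  by_contra! hno
  have hd1 : (1 : ℝ) ≤ d := Nat.one_le_cast.2 hd
  have hπ := pi_pos
  have hA0 : 0 < ((d : ℝ) + 4) / (2 * π) := by positivity
  obtain ⟨β, hβα, hβ, hsin⟩ := exists_angle_sin_lt (α := 2 * π / ((d : ℝ) + 4)) (by positivity)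
    (by rw [div_lt_iff₀ (by positivity)]; nlinarith)
  have hα0 : 0 < 2 * π / ((d : ℝ) + 4) := by positivity
  have hβ0 : 0 < β := hα0.trans hβα
  have hsq : ∀ k ≤ d, closure (S k) ⊆ unitSquare := by
    intro k
    induction k with
    | zero => intro _; rw [hS0, isClosed_unitSquare.closure_eq]
    | succ k ih =>
      intro hk
      refine (closure_mono ?_).trans (ih (by omega))
      rw [← hunion k (by omega)]
      exact Set.subset_union_left
  have main : ∀ k ≤ d, ∃ N : Finset (ℝ × ℝ), N.card = k + 4 ∧
      IsFatPolygon β (2 * cutDiam d k) (1 / 4 + 2 * cutDiam d k) N (closure (S k)) := by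
    intro k
    induction k with
    | zero =>
      intro _
      obtain ⟨N, hN, h⟩ := exists_isFatPolygon_unitSquare hβ0 hβ
      have := cutDiam_zero_le d
      refine ⟨N, by rw [hN], ?_⟩
      rw [hS0, isClosed_unitSquare.closure_eq]
      exact h.mono (by linarith) (by linarith)
    | succ k ih =>
      intro hk
      have hkd : k < d := hk
      obtain ⟨N, hN, h⟩ := ih hkd.le
      have hD := cutDiam_pos d k
      have hD' := cutDiam_pos d (k + 1)
      have hDs := cutDiam_succ_le d k
      have hε := cutArea_pos d k
      have hεA : cutArea d k * (((d : ℝ) + 4) / (2 * π)) = cutDiam d k ^ 2 :=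
        div_mul_cancel₀ _ hA0.ne'
      have hQpos : 0 < (volume (Q k)).toReal := by rw [hQvol k hkd]; exact hε
      obtain ⟨φ, c, h1, h2⟩ := exists_halfPlane_cut (hS (k + 1) hk) (hQ k hkd) (hS k hkd.le)
        (hunion k hkd) (hSvol (k + 1) hk) hQpos (hdisj k hkd)
      have hsub : closure (Q k) ⊆ unitSquare := by
        rw [h2]; exact Set.inter_subset_left.trans (hsq k hkd.le)
      have hdiam : Metric.diam (Q k) ≤ cutDiam d k := by
        have := hno k hkd
        rw [div_lt_iff₀ hQpos, hQvol k hkd, mul_comm, hεA] at this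
        exact (lt_of_pow_lt_pow_left₀ 2 hD.le this).le
      have hvol : volume (closure (Q k)) = volume (Q k) :=
        measure_closure_of_null_frontier ((hQ k hkd).addHaar_frontier volume)
      have hfac : 2 * π * (1 / ((d : ℝ) + 4)) * (((d : ℝ) + 4) / (2 * π)) = 1 := by
        field_simp
      obtain ⟨N', hN', h'⟩ := h.cut (φ := φ) (c := c) (D := cutDiam d k) (ε := cutArea d k)
        (H := cutArea d k / (4 * cutDiam d k)) (ℓ' := 2 * cutDiam d (k + 1))
        (r' := 1 / 4 + 2 * cutDiam d (k + 1)) hβ0 hβ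
        (fun x hx => dist_squareCenter_le (hsq k hkd.le hx))
        (fun x hx y hy hxc hyc => by
          refine le_trans ?_ hdiam
          rw [← Metric.diam_closure]
          apply Metric.dist_le_diam_of_mem (isBounded_unitSquare.subset hsub)
          · rw [h2]; exact ⟨hx, hxc⟩
          · rw [h2]; exact ⟨hy, hyc⟩)
        hD (by linarith) (by linarith)
        (by
          rw [← h2, hvol, ← hQvol k hkd]
          exact ENNReal.ofReal_toReal_le)
        (by
          have e : cutArea d k = 2 * π / ((d : ℝ) + 4) * (cutDiam d k * cutDiam d k) := by
            unfold cutArea; field_simp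
          rw [e, mul_assoc]
          exact mul_lt_mul_of_pos_right hsin (mul_pos hD hD))
        hε (by positivity)
        (by
          have e : cutArea d k / (4 * cutDiam d k) * (2 * cutDiam d k) = cutArea d k / 2 := by
            field_simp; norm_num
          rw [e]; linarith)
        (by linarith)
        (by
          have e1 : cutArea d k / (4 * cutDiam d k) = 8 * π * cutDiam d (k + 1) := by
            rw [cutDiam_succ]; unfold cutArea; field_simp; norm_num
          rw [e1]
          have e2 : 0 ≤ cutDiam d k * (8 * π * cutDiam d (k + 1)) := by positivity
          have e3 := mul_le_mul_of_nonneg_right pi_gt_three.le hD'.le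
          nlinarith)
        (by linarith)
      refine ⟨N', by omega, ?_⟩
      rw [h1]
      exact h'
  obtain ⟨N, hN, h⟩ := main d le_rfl
  have hcard := h.card_mul_le hβ0 (by linarith)
    (ρ := (2 * π / ((d : ℝ) + 4) + β) / 2) (by linarith)
  rw [hN] at hcard
  push_cast at hcard
  have hα : ((d : ℝ) + 4) * (2 * π / ((d : ℝ) + 4)) = 2 * π := mul_div_cancel₀ _ (by positivity)
  nlinarith

/-- The caterpillar of depth `d`: the spine consists of the even vertices, and each spine vertex
`2 * k` with `k < d` has the leaf `2 * k + 1` and the spine vertex `2 * k + 2` as children. -/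
def caterpillarParent (d : ℕ) (v : Fin (2 * d + 1)) : Fin (2 * d + 1) :=
  ⟨2 * ((v.1 - 1) / 2), by omega⟩

lemma iterate_caterpillarParent (d k : ℕ) (v : Fin (2 * d + 1)) :
    (((caterpillarParent d)^[k] v).1 + 1) / 2 = (v.1 + 1) / 2 - k := by
  induction k with
  | zero => simp
  | succ k ih =>
    rw [Function.iterate_succ_apply']
    simp only [caterpillarParent] at *
    omega

lemma iterate_caterpillarParent_eq_zero (d k : ℕ) (v : Fin (2 * d + 1)) :
    (caterpillarParent d)^[k] v = 0 ↔ (v.1 + 1) / 2 ≤ k := by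
  have := iterate_caterpillarParent d k v
  rw [Fin.ext_iff, Fin.val_zero]
  omega

/-- The caterpillar as a rooted tree. -/
def caterpillar (d : ℕ) : FRTree (Fin (2 * d + 1)) where
  root := 0
  parent := caterpillarParent d
  root_fixed := by simp [caterpillarParent]
  reaches v := ⟨_, (iterate_caterpillarParent_eq_zero d _ v).2 le_rfl⟩

lemma frNodeDepth_caterpillar (d : ℕ) (v : Fin (2 * d + 1)) :
    frNodeDepth (caterpillar d) v = (v.1 + 1) / 2 := by
  unfold frNodeDepth
  rw [Nat.find_eq_iff]
  exact ⟨(iterate_caterpillarParent_eq_zero d _ v).2 le_rfl,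
    fun k hk h => absurd ((iterate_caterpillarParent_eq_zero d k v).1 h) (not_le.2 hk)⟩

lemma frDepth_caterpillar (d : ℕ) : frDepth (caterpillar d) = d := by
  unfold frDepth
  apply le_antisymm
  · refine Finset.sup_le fun v _ => ?_
    rw [frNodeDepth_caterpillar]
    omega
  · have h := Finset.le_sup (f := frNodeDepth (caterpillar d)) (Finset.mem_univ (Fin.last (2 * d)))
    rw [frNodeDepth_caterpillar, Fin.val_last] at h
    omega

lemma mem_frChildren_caterpillar {d : ℕ} {u v : Fin (2 * d + 1)} :
    u ∈ frChildren (caterpillar d) v ↔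
      v.1 % 2 = 0 ∧ (u.1 = v.1 + 1 ∨ u.1 = v.1 + 2) := by
  simp only [frChildren, Finset.mem_filter, Finset.mem_univ, true_and, caterpillar,
    caterpillarParent, Fin.ext_iff, ne_eq]
  omega

/-- The `v`-th vertex of the caterpillar. -/
def caterpillarVertex (d v : ℕ) : Fin (2 * d + 1) := Fin.ofNat (2 * d + 1) v

lemma caterpillarVertex_val {d v : ℕ} (h : v ≤ 2 * d) : (caterpillarVertex d v).1 = v :=
  Nat.mod_eq_of_lt (by omega)

lemma frChildren_caterpillar {d k : ℕ} (hk : k < d) :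
    frChildren (caterpillar d) (caterpillarVertex d (2 * k)) =
      {caterpillarVertex d (2 * k + 2), caterpillarVertex d (2 * k + 1)} := by
  ext u
  rw [mem_frChildren_caterpillar, Finset.mem_insert, Finset.mem_singleton, Fin.ext_iff,
    Fin.ext_iff, caterpillarVertex_val (by omega), caterpillarVertex_val (by omega),
    caterpillarVertex_val (by omega)]
  omega

lemma exists_eq_caterpillarVertex {d : ℕ} {v : Fin (2 * d + 1)}
    (h : (frChildren (caterpillar d) v).Nonempty) :
    ∃ k < d, v = caterpillarVertex d (2 * k) := by
  obtain ⟨u, hu⟩ := h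
  rw [mem_frChildren_caterpillar] at hu
  refine ⟨v.1 / 2, by omega, ?_⟩
  rw [Fin.ext_iff, caterpillarVertex_val (by omega)]
  omega

/-- The weights of the caterpillar: leaves take the cut areas and the spine the remaining area. -/
noncomputable def caterpillarWeight (d : ℕ) (v : Fin (2 * d + 1)) : ℝ :=
  if v.1 % 2 = 0 then 1 - ∑ i ∈ Finset.range (v.1 / 2), cutArea d i else cutArea d (v.1 / 2)

lemma caterpillarWeight_spine {d k : ℕ} (hk : k ≤ d) :
    caterpillarWeight d (caterpillarVertex d (2 * k))
      = 1 - ∑ i ∈ Finset.range k, cutArea d i := by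
  unfold caterpillarWeight
  rw [caterpillarVertex_val (by omega), if_pos (by omega), Nat.mul_div_cancel_left k two_pos]

lemma caterpillarWeight_leaf {d k : ℕ} (hk : k < d) :
    caterpillarWeight d (caterpillarVertex d (2 * k + 1)) = cutArea d k := by
  unfold caterpillarWeight
  rw [caterpillarVertex_val (by omega), if_neg (by omega), show (2 * k + 1) / 2 = k by omega]

lemma caterpillarWeight_pos (d : ℕ) (v : Fin (2 * d + 1)) : 0 < caterpillarWeight d v := by
  unfold caterpillarWeight
  split_ifs
  · linarith [sum_cutArea_le d (v.1 / 2), cutDiam_pos d (v.1 / 2)]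
  · exact cutArea_pos d _

lemma caterpillarVertex_succ_ne {d k : ℕ} (hk : k < d) :
    caterpillarVertex d (2 * k + 2) ≠ caterpillarVertex d (2 * k + 1) := by
  rw [Ne, Fin.ext_iff, caterpillarVertex_val (by omega), caterpillarVertex_val (by omega)]
  omega

/-- For any `d ≥ 1` there is a properly weighted tree `T` of depth `d` such that every
polygonal partition for `T` (convex regions, root region the unit square, region areas
equal to the weights, children's regions partitioning the parent's region) contains a
region of aspect ratio at least `(d+4)/(2π)`, which is `Ω(d)`. -/
theorem stmt15 (d : ℕ) (hd : 1 ≤ d) :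
    ∃ (n : ℕ) (T : FRTree (Fin n)) (w : Fin n → ℝ),
      (∀ v, 0 < w v) ∧ w T.root = 1 ∧
      (∀ v, (frChildren T v).Nonempty → w v = ∑ u ∈ frChildren T v, w u) ∧
      frDepth T = d ∧
      ∀ P : Fin n → Set Plane,
        P T.root = unitSquare →
        (∀ v, Convex ℝ (P v)) →
        (∀ v, (volume (P v)).toReal = w v) →
        (∀ v, (frChildren T v).Nonempty → (⋃ u ∈ frChildren T v, P u) = P v) →
        (∀ v, ∀ u ∈ frChildren T v, ∀ u' ∈ frChildren T v, u ≠ u' →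
          Disjoint (interior (P u)) (interior (P u'))) →
        ∃ v, ((d : ℝ) + 4) / (2 * π) ≤ (Metric.diam (P v)) ^ 2 / (volume (P v)).toReal := by
  refine ⟨2 * d + 1, caterpillar d, caterpillarWeight d, caterpillarWeight_pos d, ?_, ?_,
    frDepth_caterpillar d, ?_⟩
  · simp [caterpillarWeight, caterpillar]
  · intro v hv
    obtain ⟨k, hk, rfl⟩ := exists_eq_caterpillarVertex hv
    rw [frChildren_caterpillar hk, Finset.sum_pair (caterpillarVertex_succ_ne hk),
      caterpillarWeight_spine hk.le, caterpillarWeight_leaf hk,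
      show 2 * k + 2 = 2 * (k + 1) by ring, caterpillarWeight_spine hk, Finset.sum_range_succ]
    ring
  · intro P hroot hconv hvol hunion hdisj
    have hne : ∀ k < d, (frChildren (caterpillar d) (caterpillarVertex d (2 * k))).Nonempty := by
      intro k hk
      rw [frChildren_caterpillar hk]
      exact Finset.insert_nonempty _ _
    obtain ⟨k, -, h⟩ := exists_le_aspectRatio_of_cuts hd
      (S := fun k => P (caterpillarVertex d (2 * k)))
      (Q := fun k => P (caterpillarVertex d (2 * k + 1))) hroot (fun k _ => hconv _)
      (fun k _ => hconv _)
      (fun k hk => by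
        have := hunion _ (hne k hk)
        rwa [frChildren_caterpillar hk, Finset.set_biUnion_insert,
          Finset.set_biUnion_singleton] at this)
      (fun k hk => hdisj (caterpillarVertex d (2 * k)) _ (by
          rw [frChildren_caterpillar hk]; exact Finset.mem_insert_self _ _) _ (by
          rw [frChildren_caterpillar hk]; simp) (caterpillarVertex_succ_ne hk))
      (fun k _ => by rw [hvol]; exact caterpillarWeight_pos d _)
      (fun k hk => by rw [hvol, caterpillarWeight_leaf hk])
    exact ⟨_, h⟩
end
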